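/- Let C = [C_1,…,C_r] be the W-characteristic set of ⟨P⟩ under the stated variable ordering, with C_i = [C_1,…,C_i] for 1 ≤ i ≤ r. If C is abnormal (i.e., not normal), then there exists an integer k with 1 ≤ k < r such that: (a) C_k is normal (and thus regular); (b) C_{k+1} is not regular; (c) writing I_{k+1} = ini(C_{k+1}) and y_l = lv(I_{k+1}), if I_{k+1} is not R-reduced with respect to C_l, then prem(I_{k+1}, C_l) = 0 and prem(C_{k+1}, C_k) = 0; and (d) if I_{k+1} is R-reduced with respect to C_l, then prem(C_l, [C_1,…,C_{l−1}, I_{k+1}]) = 0 and either res(ini(I_{k+1}), [C_1,…,C_{l−1}]) = 0 or prem(C_{k+1}, [C_1,…,C_{l−1}, I_{k+1}, C_{l+1},…,C_k]) = 0. -/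

import Mathlib

open MvPolynomial

namespace CharSets

variable {n : ℕ} {K : Type*} [Field K]

/-- The coefficient of `x_i ^ d` in `F`, as a polynomial in the remaining variables. -/
noncomputable def coefv (i : Fin n) (d : ℕ) (F : MvPolynomial (Fin n) K) :
    MvPolynomial (Fin n) K :=
  ∑ m ∈ F.support.filter (fun m => m i = d), monomial (Finsupp.erase i m) (F.coeff m)

/-- The leading coefficient of `F` with respect to the variable `x_i`. -/
noncomputable def lcv (i : Fin n) (F : MvPolynomial (Fin n) K) : MvPolynomial (Fin n) K :=
  coefv i (F.degreeOf i) F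

/-- Auxiliary pseudo-division: computes (pseudo-quotient, pseudo-remainder) pairs,
with the first argument as fuel; the total power of the leading coefficient used is
exactly the fuel, so that starting with fuel `max(l - m + 1, 0)` yields the pair
`(Q, R)` of the unique representation `lc(F,x_i)^q • G = Q*F + R` with
`q = max(l - m + 1, 0)` and `deg(R, x_i) < deg(F, x_i)`. -/
noncomputable def pdivAux (i : Fin n) (F : MvPolynomial (Fin n) K) :
    ℕ → MvPolynomial (Fin n) K × MvPolynomial (Fin n) K →
      MvPolynomial (Fin n) K × MvPolynomial (Fin n) K
  | 0, QR => QR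
  | q + 1, QR =>
    if (QR.2).degreeOf i < F.degreeOf i then
      (lcv i F ^ (q + 1) * QR.1, lcv i F ^ (q + 1) * QR.2)
    else
      pdivAux i F q
        (lcv i F * QR.1 +
            coefv i ((QR.2).degreeOf i) QR.2 * X i ^ ((QR.2).degreeOf i - F.degreeOf i),
          lcv i F * QR.2 -
            coefv i ((QR.2).degreeOf i) QR.2 * X i ^ ((QR.2).degreeOf i - F.degreeOf i) * F)

/-- The pseudo-remainder `prem(G, F, x_i)`. -/
noncomputable def prem (G F : MvPolynomial (Fin n) K) (i : Fin n) : MvPolynomial (Fin n) K :=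
  (pdivAux i F (G.degreeOf i + 1 - F.degreeOf i) (0, G)).2

/-- The pseudo-quotient `pquo(G, F, x_i)`. -/
noncomputable def pquo (G F : MvPolynomial (Fin n) K) (i : Fin n) : MvPolynomial (Fin n) K :=
  (pdivAux i F (G.degreeOf i + 1 - F.degreeOf i) (0, G)).1

/-- The class of `P`: the largest index (1-based) of a variable actually occurring in `P`;
the class of a constant is `0`. -/
noncomputable def cls (P : MvPolynomial (Fin n) K) : ℕ :=
  P.vars.sup fun i => (i : ℕ) + 1

/-- The degree of `G` in the leading variable of `P` (`0` if `P` is constant). -/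
noncomputable def degLv (G P : MvPolynomial (Fin n) K) : ℕ :=
  if h : P.vars.Nonempty then G.degreeOf (P.vars.max' h) else 0

/-- `G` is R-reduced with respect to `P`, i.e. `deg(G, lv(P)) < deg(P, lv(P))`. -/
def RReduced (G P : MvPolynomial (Fin n) K) : Prop :=
  degLv G P < degLv P P

/-- The initial of `P`: its leading coefficient w.r.t. its leading variable. -/
noncomputable def ini (P : MvPolynomial (Fin n) K) : MvPolynomial (Fin n) K :=
  if h : P.vars.Nonempty then lcv (P.vars.max' h) P else P

/-- Pseudo-remainder of `G` w.r.t. `F` in the leading variable of `F`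
(in case `F` is constant, `m = 0` and the pseudo-remainder is `0`). -/
noncomputable def premLv (G F : MvPolynomial (Fin n) K) : MvPolynomial (Fin n) K :=
  if h : F.vars.Nonempty then prem G F (F.vars.max' h) else 0

/-- Pseudo-quotient of `G` w.r.t. `F` in the leading variable of `F`. -/
noncomputable def pquoLv (G F : MvPolynomial (Fin n) K) : MvPolynomial (Fin n) K :=
  if h : F.vars.Nonempty then pquo G F (F.vars.max' h) else 0

/-- Iterated pseudo-remainder with respect to a triangular set `[T_1, …, T_r]`:
`prem(P, T) = prem(⋯prem(P, T_r, lv(T_r)), …, T_1, lv(T_1))`. -/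
noncomputable def premTS (P : MvPolynomial (Fin n) K) (L : List (MvPolynomial (Fin n) K)) :
    MvPolynomial (Fin n) K :=
  L.foldr (fun T acc => premLv acc T) P

/-- The Sylvester matrix of `F` and `G` with respect to the variable `x_i`. -/
noncomputable def sylvester (i : Fin n) (F G : MvPolynomial (Fin n) K) :
    Matrix (Fin (G.degreeOf i + F.degreeOf i)) (Fin (G.degreeOf i + F.degreeOf i))
      (MvPolynomial (Fin n) K) :=
  Matrix.of fun r c =>
    if (r : ℕ) < G.degreeOf i then
      if (r : ℕ) ≤ (c : ℕ) ∧ (c : ℕ) ≤ (r : ℕ) + F.degreeOf i then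
        coefv i (F.degreeOf i + (r : ℕ) - (c : ℕ)) F
      else 0
    else
      if (r : ℕ) - G.degreeOf i ≤ (c : ℕ) ∧ (c : ℕ) ≤ (r : ℕ) then
        coefv i (G.degreeOf i + ((r : ℕ) - G.degreeOf i) - (c : ℕ)) G
      else 0

/-- The resultant `res(F, G, x_i)` of `F` and `G` w.r.t. `x_i`
(the determinant of the Sylvester matrix). -/
noncomputable def resv (F G : MvPolynomial (Fin n) K) (i : Fin n) : MvPolynomial (Fin n) K :=
  (sylvester i F G).det

/-- Resultant of `F` and `G` w.r.t. the leading variable of `G`. -/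
noncomputable def resLv (F G : MvPolynomial (Fin n) K) : MvPolynomial (Fin n) K :=
  if h : G.vars.Nonempty then resv F G (G.vars.max' h) else F

/-- Iterated resultant with respect to a triangular set:
`res(F, T) = res(⋯res(F, T_r, lv(T_r)), …, T_1, lv(T_1))`. -/
noncomputable def resTS (F : MvPolynomial (Fin n) K) (L : List (MvPolynomial (Fin n) K)) :
    MvPolynomial (Fin n) K :=
  L.foldr (fun T acc => resLv acc T) F

/-- A triangular set: a nonempty ordered set of nonconstant polynomials with
strictly increasing classes. -/
def TriangularSet (L : List (MvPolynomial (Fin n) K)) : Prop :=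
  L ≠ [] ∧ (∀ T ∈ L, 0 < cls T) ∧ L.Chain' fun A B => cls A < cls B

/-- An ascending set: either a single nonzero constant, or a triangular set in which
every later element is R-reduced with respect to every earlier one. -/
def AscendingSet (L : List (MvPolynomial (Fin n) K)) : Prop :=
  (∃ a : K, a ≠ 0 ∧ L = [MvPolynomial.C a]) ∨
    (TriangularSet L ∧ L.Pairwise fun A B => RReduced B A)

/-- `F` has lower rank than `G`. -/
def rkLT (F G : MvPolynomial (Fin n) K) : Prop :=
  cls F < cls G ∨ (cls F = cls G ∧ 0 < cls F ∧ degLv F F < degLv G G)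

/-- `F` and `G` have the same rank: neither has lower rank than the other. -/
def rkEQ (F G : MvPolynomial (Fin n) K) : Prop :=
  ¬ rkLT F G ∧ ¬ rkLT G F

/-- `B` has lower rank than `A` (as ascending sets). -/
def ascLT (B A : List (MvPolynomial (Fin n) K)) : Prop :=
  (∃ j, j < min A.length B.length ∧
      (∀ i, i < j → rkEQ (A.getD i 0) (B.getD i 0)) ∧ rkLT (B.getD j 0) (A.getD j 0)) ∨
    (A.length < B.length ∧ ∀ i, i < A.length → rkEQ (A.getD i 0) (B.getD i 0))

/-- A Ritt characteristic set of the ideal `I`: an ascending set contained in `I`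
of minimal rank among all ascending sets contained in `I`. -/
def RittCharSet (I : Ideal (MvPolynomial (Fin n) K)) (A : List (MvPolynomial (Fin n) K)) :
    Prop :=
  AscendingSet A ∧ (∀ a ∈ A, a ∈ I) ∧
    ∀ B : List (MvPolynomial (Fin n) K), AscendingSet B → (∀ b ∈ B, b ∈ I) → ¬ ascLT B A

/-- The saturated ideal of a triangular set, as a set of polynomials. -/
def satTS (L : List (MvPolynomial (Fin n) K)) : Set (MvPolynomial (Fin n) K) :=
  {F | ∃ q : ℕ, 0 < q ∧ (L.map ini).prod ^ q * F ∈ Ideal.span {T | T ∈ L}}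

/-- A regular set: a triangular set such that `res(ini(T_j), [T_1, …, T_{j-1}]) ≠ 0`
for `j = 2, …, r`. -/
def RegularSet (L : List (MvPolynomial (Fin n) K)) : Prop :=
  TriangularSet L ∧
    ∀ j : ℕ, 0 < j → j < L.length → resTS (ini (L.getD j 0)) (L.take j) ≠ 0

/-- A normal triangular set: `deg(ini(T_j), lv(T_i)) = 0` for all `i < j`. -/
def NormalSet (L : List (MvPolynomial (Fin n) K)) : Prop :=
  TriangularSet L ∧ L.Pairwise fun A B => degLv (ini B) A = 0

/-- The purely lexicographical order on monomials determined by `x_1 < ⋯ < x_n`. -/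
def plexLT (a b : Fin n →₀ ℕ) : Prop :=
  ∃ k : Fin n, a k < b k ∧ ∀ j : Fin n, k < j → a j = b j

/-- `m` is the leading monomial of `P` w.r.t. the plex order. -/
def IsLpp (P : MvPolynomial (Fin n) K) (m : Fin n →₀ ℕ) : Prop :=
  m ∈ P.support ∧ ∀ m' ∈ P.support, m' ≠ m → plexLT m' m

/-- `G` is the reduced (Buchberger–)Gröbner basis of the ideal `I` w.r.t. the plex
term order determined by `x_1 < ⋯ < x_n`: its elements are nonzero monic members of `I`,
the leading monomial of every nonzero member of `I` is divisible by the leading monomial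
of some element of `G`, every element of `G` is B-reduced w.r.t. the others, and `G`
generates `I`. -/
def IsReducedGB (I : Ideal (MvPolynomial (Fin n) K)) (G : Finset (MvPolynomial (Fin n) K)) :
    Prop :=
  (∀ g ∈ G, g ∈ I ∧ g ≠ 0 ∧ ∀ m, IsLpp g m → g.coeff m = 1) ∧
    (∀ F ∈ I, F ≠ 0 → ∃ g ∈ G, ∃ mg mF, IsLpp g mg ∧ IsLpp F mF ∧ mg ≤ mF) ∧
    (∀ g ∈ G, ∀ g' ∈ G, g' ≠ g → ∀ m ∈ g.support, ∀ m', IsLpp g' m' → ¬ m' ≤ m) ∧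
    Ideal.span (G : Set (MvPolynomial (Fin n) K)) = I

/-- `Cs` is the W-characteristic set of `I`: the minimal triangular set contained in the
reduced plex Gröbner basis `G` of `I`, i.e. for each class realized in `G`, `Cs` contains
the element of that class whose leading monomial is minimal w.r.t. the plex order, the
elements being ordered by increasing class (equivalently, by the plex order). -/
def IsWCharSet (I : Ideal (MvPolynomial (Fin n) K)) (Cs : List (MvPolynomial (Fin n) K)) :
    Prop :=
  ∃ G : Finset (MvPolynomial (Fin n) K), IsReducedGB I G ∧
    (Cs.Chain' fun A B => cls A < cls B) ∧
    (∀ c ∈ Cs, c ∈ G) ∧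
    (∀ g ∈ G, ∃ c ∈ Cs, cls c = cls g) ∧
    ∀ c ∈ Cs, ∀ g ∈ G, cls g = cls c → g ≠ c →
      ∃ mc mg, IsLpp c mc ∧ IsLpp g mg ∧ plexLT mc mg

/-- The set of common zeros of a set `S` of polynomials over `k`, taken in `Kc ^ n`
for an extension `Kc` of `k`. -/
def zeroSet {k : Type*} [Field k] (Kc : Type*) [CommRing Kc] [Algebra k Kc]
    (S : Set (MvPolynomial (Fin n) k)) : Set (Fin n → Kc) :=
  {a | ∀ p ∈ S, MvPolynomial.aeval a p = 0}

/-! ### Polynomials as univariate polynomials in a chosen variable -/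

/-- `F` seen as a univariate polynomial in the variable `x_i`. -/
noncomputable def toPoly (i : Fin n) :
    MvPolynomial (Fin n) K →ₐ[K] Polynomial (MvPolynomial (Fin n) K) :=
  aeval fun j => if j = i then Polynomial.X else Polynomial.C (X j)

theorem eval_toPoly (i : Fin n) (F : MvPolynomial (Fin n) K) :
    (toPoly i F).eval (X i) = F := by
  have h : ((Polynomial.aeval (X i : MvPolynomial (Fin n) K)).restrictScalars K).comp
      (toPoly (K := K) i) = AlgHom.id K _ := by
    ext j
    by_cases hj : j = i <;> simp [toPoly, hj]
  simpa [Polynomial.coe_aeval_eq_eval] using DFunLike.congr_fun h F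

theorem toPoly_X (i : Fin n) : toPoly (K := K) i (X i) = Polynomial.X := by
  simp [toPoly]

theorem toPoly_monomial (i : Fin n) (s : Fin n →₀ ℕ) (c : K) :
    toPoly i (monomial s c) = Polynomial.monomial (s i) (monomial (s.erase i) c) := by
  have hs : s = s.erase i + Finsupp.single i (s i) := (Finsupp.erase_add_single i s).symm
  have h : toPoly i (monomial (s.erase i) c) = Polynomial.C (monomial (s.erase i) c) := by
    rw [toPoly, aeval_monomial, monomial_eq, map_mul, map_finsuppProd]
    refine congrArg _ (Finsupp.prod_congr fun j hj => ?_)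
    have : j ≠ i := by
      rintro rfl
      simp at hj
    simp [this]
  conv_lhs => rw [hs, ← mul_one c, ← monomial_mul, map_mul, h, ← X_pow_eq_monomial, map_pow,
    toPoly_X, Polynomial.C_mul_X_pow_eq_monomial]

theorem coeff_toPoly (i : Fin n) (F : MvPolynomial (Fin n) K) (d : ℕ) :
    (toPoly i F).coeff d = coefv i d F := by
  conv_lhs => rw [F.as_sum]
  rw [map_sum, Polynomial.finsetSum_coeff, coefv, Finset.sum_filter]
  refine Finset.sum_congr rfl fun s _ => ?_
  rw [toPoly_monomial, Polynomial.coeff_monomial]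

theorem coefv_eq_zero {i : Fin n} {d : ℕ} {F : MvPolynomial (Fin n) K} (h : F.degreeOf i < d) :
    coefv i d F = 0 := by
  refine Finset.sum_eq_zero fun s hs => ?_
  rw [Finset.mem_filter] at hs
  have := le_degreeOf_of_mem_support i hs.1
  omega

theorem coeff_coefv {i : Fin n} (F : MvPolynomial (Fin n) K) (s : Fin n →₀ ℕ) :
    coeff (s.erase i) (coefv i (s i) F) = coeff s F := by
  rw [coefv, coeff_sum]
  by_cases hs : s ∈ F.support
  · rw [Finset.sum_eq_single s]
    · simp
    · intro t ht hts
      rw [coeff_monomial, if_neg]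
      intro h
      refine hts ?_
      rw [← Finsupp.erase_add_single i t, ← Finsupp.erase_add_single i s, h,
        (Finset.mem_filter.1 ht).2]
    · intro h
      exact absurd (by simpa using hs) h
  · rw [notMem_support_iff.1 hs]
    refine Finset.sum_eq_zero fun t ht => ?_
    rw [coeff_monomial, if_neg]
    intro h
    rw [Finset.mem_filter] at ht
    refine hs ?_
    rw [← Finsupp.erase_add_single i s, ← h, ← ht.2, Finsupp.erase_add_single]
    exact ht.1

theorem exists_mem_support_eq_degreeOf {i : Fin n} {F : MvPolynomial (Fin n) K} (hF : F ≠ 0) :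
    ∃ s ∈ F.support, s i = F.degreeOf i := by
  obtain ⟨s, hs, h⟩ := Finset.exists_mem_eq_sup F.support (support_nonempty.2 hF) fun s => s i
  exact ⟨s, hs, by rw [degreeOf_eq_sup, h]⟩

theorem lcv_ne_zero {i : Fin n} {F : MvPolynomial (Fin n) K} (hF : F ≠ 0) : lcv i F ≠ 0 := by
  obtain ⟨s, hs, h⟩ := exists_mem_support_eq_degreeOf (i := i) hF
  intro h0
  rw [lcv, ← h] at h0
  have := coeff_coefv (i := i) F s
  rw [h0, coeff_zero] at this
  exact mem_support_iff.1 hs this.symm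

theorem natDegree_toPoly (i : Fin n) (F : MvPolynomial (Fin n) K) :
    (toPoly i F).natDegree = F.degreeOf i := by
  rcases eq_or_ne F 0 with rfl | hF
  · simp
  refine Polynomial.natDegree_eq_of_le_of_coeff_ne_zero ?_ ?_
  · rw [Polynomial.natDegree_le_iff_coeff_eq_zero]
    intro N hN
    rw [coeff_toPoly, coefv_eq_zero hN]
  · rw [coeff_toPoly]
    exact lcv_ne_zero hF

theorem leadingCoeff_toPoly (i : Fin n) (F : MvPolynomial (Fin n) K) :
    (toPoly i F).leadingCoeff = lcv i F := by
  rw [Polynomial.leadingCoeff, natDegree_toPoly, coeff_toPoly, lcv]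

theorem toPoly_of_degreeOf_eq_zero {i : Fin n} {F : MvPolynomial (Fin n) K}
    (h : F.degreeOf i = 0) : toPoly i F = Polynomial.C F := by
  have h1 := Polynomial.eq_C_of_natDegree_eq_zero ((natDegree_toPoly i F).trans h)
  have h2 := eval_toPoly i F
  rw [h1, Polynomial.eval_C] at h2
  rw [h1, h2]

theorem coefv_add (i : Fin n) (d : ℕ) (F G : MvPolynomial (Fin n) K) :
    coefv i d (F + G) = coefv i d F + coefv i d G := by
  simp [← coeff_toPoly]

theorem coefv_sub (i : Fin n) (d : ℕ) (F G : MvPolynomial (Fin n) K) :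
    coefv i d (F - G) = coefv i d F - coefv i d G := by
  simp [← coeff_toPoly]

theorem coefv_mul_left {i : Fin n} (d : ℕ) {H : MvPolynomial (Fin n) K} (h : H.degreeOf i = 0)
    (F : MvPolynomial (Fin n) K) : coefv i d (H * F) = H * coefv i d F := by
  simp [← coeff_toPoly, toPoly_of_degreeOf_eq_zero h]

theorem coefv_zero_of_degreeOf_eq_zero {i : Fin n} {H : MvPolynomial (Fin n) K}
    (h : H.degreeOf i = 0) : coefv i 0 H = H := by
  simp [← coeff_toPoly, toPoly_of_degreeOf_eq_zero h]

theorem sum_coefv_mul_X_pow (i : Fin n) (F : MvPolynomial (Fin n) K) :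
    ∑ d ∈ Finset.range (F.degreeOf i + 1), coefv i d F * X i ^ d = F := by
  conv_rhs => rw [← eval_toPoly i F, Polynomial.eval_eq_sum_range, natDegree_toPoly]
  simp_rw [coeff_toPoly]

theorem degreeOf_coefv_le (i j : Fin n) (d : ℕ) (F : MvPolynomial (Fin n) K) :
    (coefv i d F).degreeOf j ≤ F.degreeOf j := by
  refine (degreeOf_sum_le _ _ _).trans (Finset.sup_le fun s hs => ?_)
  rw [Finset.mem_filter] at hs
  rw [degreeOf_monomial_eq _ _ (mem_support_iff.1 hs.1)]
  refine le_trans ?_ (le_degreeOf_of_mem_support j hs.1)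
  by_cases h : j = i
  · simp [h]
  · simp [Finsupp.erase_ne h]

theorem degreeOf_coefv_self (i : Fin n) (d : ℕ) (F : MvPolynomial (Fin n) K) :
    (coefv i d F).degreeOf i = 0 := by
  refine Nat.le_zero.1 ((degreeOf_sum_le _ _ _).trans (Finset.sup_le fun s hs => ?_))
  rw [Finset.mem_filter] at hs
  rw [degreeOf_monomial_eq _ _ (mem_support_iff.1 hs.1)]
  simp

theorem lcv_mul (i : Fin n) (F G : MvPolynomial (Fin n) K) :
    lcv i (F * G) = lcv i F * lcv i G := by
  simp [← leadingCoeff_toPoly]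

theorem degreeOf_sub_lcv_mul_lt {i : Fin n} {F : MvPolynomial (Fin n) K}
    (h : 0 < F.degreeOf i) :
    (F - lcv i F * X i ^ F.degreeOf i).degreeOf i < F.degreeOf i := by
  have hlc : (lcv i F).degreeOf i = 0 := degreeOf_coefv_self _ _ _
  rw [← natDegree_toPoly i F] at h
  rw [← natDegree_toPoly, map_sub, map_mul, map_pow, toPoly_X, toPoly_of_degreeOf_eq_zero hlc,
    ← leadingCoeff_toPoly, ← natDegree_toPoly i F, Polynomial.self_sub_C_mul_X_pow]
  have := (toPoly i F).eraseLead_natDegree_le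
  omega

theorem degreeOf_mul_eq_zero {j : Fin n} {F G : MvPolynomial (Fin n) K} (hF : F.degreeOf j = 0)
    (hG : G.degreeOf j = 0) : (F * G).degreeOf j = 0 := by
  have := degreeOf_mul_le j F G
  omega

theorem degreeOf_mul_le_of_left {j : Fin n} {F : MvPolynomial (Fin n) K} (hF : F.degreeOf j = 0)
    (G : MvPolynomial (Fin n) K) : (F * G).degreeOf j ≤ G.degreeOf j := by
  have := degreeOf_mul_le j F G
  omega

theorem degreeOf_pow_eq_zero {j : Fin n} {F : MvPolynomial (Fin n) K} (hF : F.degreeOf j = 0)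
    (d : ℕ) : (F ^ d).degreeOf j = 0 := by
  have := degreeOf_pow_le j F d
  simpa [hF] using this

theorem degreeOf_sub_eq_zero {j : Fin n} {F G : MvPolynomial (Fin n) K} (hF : F.degreeOf j = 0)
    (hG : G.degreeOf j = 0) : (F - G).degreeOf j = 0 := by
  have := degreeOf_sub_le j F G
  simpa [hF, hG] using this

/-! ### Classes and leading variables -/

theorem mem_vars_iff_degreeOf_pos {P : MvPolynomial (Fin n) K} {j : Fin n} :
    j ∈ P.vars ↔ 0 < P.degreeOf j := by
  classical
  rw [vars_def, Multiset.mem_toFinset, degreeOf_def, Multiset.count_pos]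

theorem cls_eq_succ_iff {P : MvPolynomial (Fin n) K} {i : Fin n} :
    cls P = i + 1 ↔ 0 < P.degreeOf i ∧ ∀ j, i < j → P.degreeOf j = 0 := by
  constructor
  · intro h
    have hle : ∀ j ∈ P.vars, j ≤ i := fun j hj => by
      have := Finset.le_sup (f := fun i : Fin n => (i : ℕ) + 1) hj
      rw [cls] at h
      simp only [h] at this
      exact Fin.le_def.2 (by omega)
    refine ⟨?_, fun j hj => ?_⟩
    · have hne : P.vars.Nonempty := by
        by_contra hne
        rw [Finset.not_nonempty_iff_eq_empty] at hne
        simp [cls, hne] at h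
      obtain ⟨j, hj, hj'⟩ :=
        Finset.exists_mem_eq_sup P.vars hne (fun i : Fin n => (i : ℕ) + 1)
      rw [cls, hj'] at h
      have : j = i := Fin.ext (by omega)
      exact mem_vars_iff_degreeOf_pos.1 (this ▸ hj)
    · by_contra hj'
      exact absurd (hle j (mem_vars_iff_degreeOf_pos.2 (Nat.pos_of_ne_zero hj'))) (not_le.2 hj)
  · rintro ⟨h1, h2⟩
    refine le_antisymm (Finset.sup_le fun j hj => ?_)
      (Finset.le_sup (f := fun i : Fin n => (i : ℕ) + 1) (mem_vars_iff_degreeOf_pos.2 h1))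
    have : ¬ i < j := fun hij => by
      have := mem_vars_iff_degreeOf_pos.1 hj
      rw [h2 j hij] at this
      omega
    have := Fin.le_def.1 (not_lt.1 this)
    omega

theorem exists_cls_eq_succ {P : MvPolynomial (Fin n) K} (h : 0 < cls P) :
    ∃ i : Fin n, cls P = i + 1 := by
  have hne : P.vars.Nonempty := by
    by_contra hne
    rw [Finset.not_nonempty_iff_eq_empty] at hne
    simp [cls, hne] at h
  obtain ⟨j, -, hj'⟩ := Finset.exists_mem_eq_sup P.vars hne (fun i : Fin n => (i : ℕ) + 1)
  exact ⟨j, hj'⟩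

theorem exists_max'_eq {P : MvPolynomial (Fin n) K} {i : Fin n} (h : cls P = i + 1) :
    ∃ hne : P.vars.Nonempty, P.vars.max' hne = i := by
  obtain ⟨h1, h2⟩ := cls_eq_succ_iff.1 h
  have hi := mem_vars_iff_degreeOf_pos.2 h1
  refine ⟨⟨i, hi⟩, le_antisymm (Finset.max'_le _ _ _ fun j hj => ?_) (Finset.le_max' _ _ hi)⟩
  by_contra hij
  have := mem_vars_iff_degreeOf_pos.1 hj
  rw [h2 j (not_le.1 hij)] at this
  omega

theorem ini_eq {P : MvPolynomial (Fin n) K} {i : Fin n} (h : cls P = i + 1) :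
    ini P = lcv i P := by
  obtain ⟨hne, rfl⟩ := exists_max'_eq h
  rw [ini, dif_pos hne]

theorem premLv_eq {P : MvPolynomial (Fin n) K} {i : Fin n} (h : cls P = i + 1)
    (G : MvPolynomial (Fin n) K) : premLv G P = prem G P i := by
  obtain ⟨hne, rfl⟩ := exists_max'_eq h
  rw [premLv, dif_pos hne]

theorem resLv_eq {P : MvPolynomial (Fin n) K} {i : Fin n} (h : cls P = i + 1)
    (G : MvPolynomial (Fin n) K) : resLv G P = resv G P i := by
  obtain ⟨hne, rfl⟩ := exists_max'_eq h
  rw [resLv, dif_pos hne]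

theorem degLv_eq {P : MvPolynomial (Fin n) K} {i : Fin n} (h : cls P = i + 1)
    (G : MvPolynomial (Fin n) K) : degLv G P = G.degreeOf i := by
  obtain ⟨hne, rfl⟩ := exists_max'_eq h
  rw [degLv, dif_pos hne]

theorem degreeOf_ini_eq_zero {P : MvPolynomial (Fin n) K} {i : Fin n} (h : cls P = i + 1)
    {j : Fin n} (hj : i ≤ j) : (ini P).degreeOf j = 0 := by
  rw [ini_eq h]
  rcases hj.eq_or_lt with rfl | hj
  · exact degreeOf_coefv_self _ _ _
  · have := degreeOf_coefv_le i j (P.degreeOf i) P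
    rw [(cls_eq_succ_iff.1 h).2 j hj] at this
    exact Nat.le_zero.1 this

theorem ne_zero_of_cls_eq_succ {P : MvPolynomial (Fin n) K} {i : Fin n} (h : cls P = i + 1) :
    P ≠ 0 := by
  rintro rfl
  have := (cls_eq_succ_iff.1 h).1
  simp at this

theorem ini_ne_zero {P : MvPolynomial (Fin n) K} {i : Fin n} (h : cls P = i + 1) :
    ini P ≠ 0 := by
  rw [ini_eq h]
  exact lcv_ne_zero (ne_zero_of_cls_eq_succ h)

/-! ### Pseudo-division -/

theorem degreeOf_pdiv_step_lt {i : Fin n} {F R : MvPolynomial (Fin n) K}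
    (hF : 0 < F.degreeOf i) (hR : F.degreeOf i ≤ R.degreeOf i) :
    (lcv i F * R - coefv i (R.degreeOf i) R * X i ^ (R.degreeOf i - F.degreeOf i) * F).degreeOf i
      < R.degreeOf i := by
  have hX : (X i : MvPolynomial (Fin n) K) ^ R.degreeOf i =
      X i ^ (R.degreeOf i - F.degreeOf i) * X i ^ F.degreeOf i := by
    rw [← pow_add, Nat.sub_add_cancel hR]
  have key : lcv i F * R - coefv i (R.degreeOf i) R * X i ^ (R.degreeOf i - F.degreeOf i) * F =
      lcv i F * (R - lcv i R * X i ^ R.degreeOf i) -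
        lcv i R * X i ^ (R.degreeOf i - F.degreeOf i) * (F - lcv i F * X i ^ F.degreeOf i) := by
    rw [hX]
    simp only [lcv]
    ring
  rw [key]
  refine (degreeOf_sub_le _ _ _).trans_lt (max_lt ?_ ?_)
  · exact (degreeOf_mul_le_of_left (degreeOf_coefv_self _ _ _) _).trans_lt
      (degreeOf_sub_lcv_mul_lt (hF.trans_le hR))
  · have h1 := degreeOf_mul_le i (lcv i R * X i ^ (R.degreeOf i - F.degreeOf i))
      (F - lcv i F * X i ^ F.degreeOf i)
    have h2 := degreeOf_mul_le_of_left
      (show (lcv i R).degreeOf i = 0 from degreeOf_coefv_self _ _ _)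
      (X i ^ (R.degreeOf i - F.degreeOf i))
    rw [degreeOf_X_self_pow] at h2
    have h3 := degreeOf_sub_lcv_mul_lt hF
    omega

theorem pdivAux_spec {i : Fin n} {F : MvPolynomial (Fin n) K} (hF : 0 < F.degreeOf i) (q : ℕ)
    (Q₀ R₀ : MvPolynomial (Fin n) K) (hq : R₀.degreeOf i < F.degreeOf i + q) :
    (pdivAux i F q (Q₀, R₀)).2.degreeOf i < F.degreeOf i ∧
      (∃ e B, lcv i F ^ e * R₀ = B * F + (pdivAux i F q (Q₀, R₀)).2) ∧
      ∀ j, F.degreeOf j = 0 → (pdivAux i F q (Q₀, R₀)).2.degreeOf j ≤ R₀.degreeOf j := by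
  induction q generalizing Q₀ R₀ with
  | zero => exact ⟨by simpa [pdivAux] using hq, ⟨0, 0, by simp [pdivAux]⟩, fun j _ => le_rfl⟩
  | succ q ih =>
    have hlc : ∀ j, F.degreeOf j = 0 → (lcv i F).degreeOf j = 0 := fun j hj =>
      Nat.le_zero.1 ((degreeOf_coefv_le i j _ F).trans hj.le)
    by_cases h : R₀.degreeOf i < F.degreeOf i
    · have hp : pdivAux i F (q + 1) (Q₀, R₀) =
          (lcv i F ^ (q + 1) * Q₀, lcv i F ^ (q + 1) * R₀) := by
        rw [pdivAux, if_pos h]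
      rw [hp]
      refine ⟨?_, ⟨q + 1, 0, by simp⟩, fun j hj => ?_⟩
      · exact (degreeOf_mul_le_of_left
          (degreeOf_pow_eq_zero (degreeOf_coefv_self _ _ _) _) _).trans_lt h
      · exact degreeOf_mul_le_of_left (degreeOf_pow_eq_zero (hlc j hj) _) _
    · rw [pdivAux, if_neg h]
      have hlt := degreeOf_pdiv_step_lt hF (not_lt.1 h)
      obtain ⟨h1, ⟨e, B, h2⟩, h3⟩ := ih
        (lcv i F * Q₀ + coefv i (R₀.degreeOf i) R₀ * X i ^ (R₀.degreeOf i - F.degreeOf i))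
        (lcv i F * R₀ -
          coefv i (R₀.degreeOf i) R₀ * X i ^ (R₀.degreeOf i - F.degreeOf i) * F) (by omega)
      refine ⟨h1, ⟨e + 1, B + lcv i F ^ e * (coefv i (R₀.degreeOf i) R₀ *
        X i ^ (R₀.degreeOf i - F.degreeOf i)), by linear_combination h2⟩,
        fun j hj => (h3 j hj).trans ?_⟩
      have hji : j ≠ i := by
        rintro rfl
        omega
      refine (degreeOf_sub_le _ _ _).trans (max_le (degreeOf_mul_le_of_left (hlc j hj) _) ?_)
      have g1 := degreeOf_mul_le j (coefv i (R₀.degreeOf i) R₀ *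
        X i ^ (R₀.degreeOf i - F.degreeOf i)) F
      have g2 : (coefv i (R₀.degreeOf i) R₀ * X i ^ (R₀.degreeOf i - F.degreeOf i)).degreeOf j =
          (coefv i (R₀.degreeOf i) R₀).degreeOf j := degreeOf_mul_X_pow_of_ne _ hji
      have g3 := degreeOf_coefv_le i j (R₀.degreeOf i) R₀
      omega

theorem prem_spec {i : Fin n} {F : MvPolynomial (Fin n) K} (hF : 0 < F.degreeOf i)
    (G : MvPolynomial (Fin n) K) :
    (prem G F i).degreeOf i < F.degreeOf i ∧
      (∃ e B, lcv i F ^ e * G = B * F + prem G F i) ∧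
      ∀ j, F.degreeOf j = 0 → (prem G F i).degreeOf j ≤ G.degreeOf j :=
  pdivAux_spec hF _ _ _ (by omega)

theorem premTS_spec (F : MvPolynomial (Fin n) K) {L : List (MvPolynomial (Fin n) K)}
    (hpos : ∀ T ∈ L, 0 < cls T) (hL : L.Pairwise fun A B => cls A < cls B) :
    (∀ T ∈ L, ∀ i : Fin n, cls T = i + 1 → (premTS F L).degreeOf i < T.degreeOf i) ∧
      (∀ j, (∀ T ∈ L, T.degreeOf j = 0) → (premTS F L).degreeOf j ≤ F.degreeOf j) ∧
      ∃ h ∈ Submonoid.closure {I | ∃ T ∈ L, I = ini T},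
        h * F - premTS F L ∈ Ideal.span {T | T ∈ L} := by
  induction L with
  | nil => exact ⟨by simp, fun j _ => le_rfl, 1, one_mem _, by simp [premTS]⟩
  | cons T L ih =>
    rw [List.pairwise_cons] at hL
    obtain ⟨h1, h2, h, hh, h3⟩ := ih (fun S hS => hpos S (List.mem_cons_of_mem _ hS)) hL.2
    obtain ⟨i, hi⟩ := exists_cls_eq_succ (hpos T List.mem_cons_self)
    have hrec : premTS F (T :: L) = prem (premTS F L) T i := by
      rw [← premLv_eq hi]
      rfl
    rw [hrec]
    obtain ⟨hT, hT'⟩ := cls_eq_succ_iff.1 hi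
    obtain ⟨g1, ⟨e, B, g2⟩, g3⟩ := prem_spec hT (premTS F L)
    refine ⟨fun S hS j hj => ?_, fun j hj => ?_, ini T ^ e * h, ?_, ?_⟩
    · rcases List.mem_cons.1 hS with rfl | hS
      · have : j = i := Fin.ext (by omega)
        rwa [this]
      · have hij : i < j := Fin.lt_def.2 (by have := hL.1 S hS; omega)
        exact (g3 j (hT' j hij)).trans_lt (h1 S hS j hj)
    · exact (g3 j (hj T List.mem_cons_self)).trans
        (h2 j fun S hS => hj S (List.mem_cons_of_mem _ hS))
    · have hT : ini T ∈ {I | ∃ S ∈ T :: L, I = ini S} := ⟨T, List.mem_cons_self, rfl⟩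
      refine mul_mem (pow_mem (Submonoid.subset_closure hT) _) (Submonoid.closure_mono ?_ hh)
      rintro _ ⟨S, hS, rfl⟩
      exact ⟨S, List.mem_cons_of_mem _ hS, rfl⟩
    · rw [ini_eq hi]
      have : lcv i T ^ e * h * F - prem (premTS F L) T i =
          lcv i T ^ e * (h * F - premTS F L) + B * T := by
        linear_combination g2
      rw [this]
      refine add_mem (Ideal.mul_mem_left _ _ (Ideal.span_mono ?_ h3))
        (Ideal.mul_mem_left _ _ (Ideal.subset_span List.mem_cons_self))
      exact fun S hS => List.mem_cons_of_mem _ hS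

/-! ### Resultants -/

theorem sum_band_mul_X_pow (i : Fin n) (F : MvPolynomial (Fin n) K) (a N : ℕ)
    (h : a + F.degreeOf i < N) :
    ∑ c : Fin N, (if a ≤ (c : ℕ) ∧ (c : ℕ) ≤ a + F.degreeOf i then
      coefv i (F.degreeOf i + a - c) F else 0) * X i ^ (N - 1 - c) =
      X i ^ (N - 1 - (a + F.degreeOf i)) * F := by
  rw [Fin.sum_univ_eq_sum_range (fun c => (if a ≤ c ∧ c ≤ a + F.degreeOf i then
      coefv i (F.degreeOf i + a - c) F else 0) * X i ^ (N - 1 - c))]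
  have hF := congrArg (X i ^ (N - 1 - (a + F.degreeOf i)) * ·) (sum_coefv_mul_X_pow i F)
  simp only [Finset.mul_sum] at hF
  rw [← hF]
  simp_rw [ite_mul, zero_mul]
  rw [← Finset.sum_filter]
  refine Finset.sum_nbij' (fun c => F.degreeOf i + a - c) (fun d => F.degreeOf i + a - d)
    ?_ ?_ ?_ ?_ ?_
  · intro c hc
    simp only [Finset.mem_filter, Finset.mem_range] at hc ⊢
    omega
  · intro d hd
    simp only [Finset.mem_filter, Finset.mem_range] at hd ⊢
    omega
  · intro c hc
    simp only [Finset.mem_filter, Finset.mem_range] at hc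
    omega
  · intro d hd
    simp only [Finset.mem_range] at hd
    omega
  · intro c hc
    simp only [Finset.mem_filter, Finset.mem_range] at hc
    rw [mul_left_comm, ← pow_add]
    congr 2
    omega

theorem resv_mem_span {i : Fin n} {T : MvPolynomial (Fin n) K} (hT : 0 < T.degreeOf i)
    (F : MvPolynomial (Fin n) K) : resv F T i ∈ Ideal.span {F, T} := by
  have hN : 0 < T.degreeOf i + F.degreeOf i := by omega
  set N := T.degreeOf i + F.degreeOf i with hNdef
  let v : Fin N → MvPolynomial (Fin n) K := fun c => X i ^ (N - 1 - c)
  have hrow : ∀ r, (sylvester i F T).mulVec v r ∈ Ideal.span {F, T} := by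
    intro r
    have hr := r.2
    by_cases h : (r : ℕ) < T.degreeOf i
    · have := sum_band_mul_X_pow i F r N (by omega)
      simp only [Matrix.mulVec, dotProduct, sylvester, Matrix.of_apply, if_pos h, v]
      rw [this]
      exact Ideal.mul_mem_left _ _ (Ideal.subset_span (by simp))
    · have hr' : (r : ℕ) - T.degreeOf i + T.degreeOf i = r := Nat.sub_add_cancel (not_lt.1 h)
      have := sum_band_mul_X_pow i T (r - T.degreeOf i) N (by omega)
      rw [hr'] at this
      simp only [Matrix.mulVec, dotProduct, sylvester, Matrix.of_apply, if_neg h, v]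
      rw [this]
      exact Ideal.mul_mem_left _ _ (Ideal.subset_span (by simp))
  have h1 : (sylvester i F T).adjugate.mulVec ((sylvester i F T).mulVec v) ⟨N - 1, by omega⟩ =
      resv F T i := by
    rw [Matrix.mulVec_mulVec, Matrix.adjugate_mul, Matrix.smul_mulVec, Matrix.one_mulVec]
    simp [v, resv]
  rw [← h1]
  change ∑ c : Fin N, (sylvester i F T).adjugate _ c * (sylvester i F T).mulVec v c ∈ _
  exact sum_mem fun c _ => Ideal.mul_mem_left _ _ (hrow c)

theorem degreeOf_det_eq_zero {j : Fin n} {N : ℕ}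
    {M : Matrix (Fin N) (Fin N) (MvPolynomial (Fin n) K)} (h : ∀ r c, (M r c).degreeOf j = 0) :
    M.det.degreeOf j = 0 := by
  rw [Matrix.det_apply]
  refine Nat.le_zero.1 ((degreeOf_sum_le _ _ _).trans (Finset.sup_le fun σ _ => ?_))
  have h1 : (∏ c, M (σ c) c).degreeOf j = 0 :=
    Nat.le_zero.1 ((degreeOf_prod_le _ _ _).trans (by simp [h]))
  rcases Int.units_eq_one_or (Equiv.Perm.sign σ) with hs | hs <;> simp [hs, h1, degreeOf_neg]

theorem degreeOf_resv_self (i : Fin n) (F T : MvPolynomial (Fin n) K) :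
    (resv F T i).degreeOf i = 0 := by
  refine degreeOf_det_eq_zero fun r c => ?_
  simp only [sylvester, Matrix.of_apply]
  split_ifs <;> simp [degreeOf_coefv_self]

theorem degreeOf_resv_eq_zero {i j : Fin n} {F T : MvPolynomial (Fin n) K}
    (hF : F.degreeOf j = 0) (hT : T.degreeOf j = 0) : (resv F T i).degreeOf j = 0 := by
  have h : ∀ G : MvPolynomial (Fin n) K, G.degreeOf j = 0 → ∀ d, (coefv i d G).degreeOf j = 0 :=
    fun G hG d => Nat.le_zero.1 ((degreeOf_coefv_le i j d G).trans hG.le)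
  refine degreeOf_det_eq_zero fun r c => ?_
  simp only [sylvester, Matrix.of_apply]
  split_ifs <;> simp [h _ hF, h _ hT]

theorem resv_of_degreeOf_eq_zero {i : Fin n} {F : MvPolynomial (Fin n) K}
    (hF : F.degreeOf i = 0) (T : MvPolynomial (Fin n) K) :
    resv F T i = F ^ T.degreeOf i := by
  have h : sylvester i F T = Matrix.diagonal fun _ => F := by
    ext1 r c
    have hr : (r : ℕ) < T.degreeOf i := by have := r.2; omega
    simp only [sylvester, Matrix.of_apply, if_pos hr, hF, Matrix.diagonal_apply, Fin.ext_iff]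
    by_cases hrc : (r : ℕ) = c
    · rw [if_pos (by omega), if_pos hrc, ← hrc, show 0 + (r : ℕ) - r = 0 by omega,
        coefv_zero_of_degreeOf_eq_zero hF]
    · rw [if_neg (by omega), if_neg hrc]
  rw [resv, h, Matrix.det_diagonal, Finset.prod_const, Finset.card_univ, Fintype.card_fin, hF,
    add_zero]

theorem resTS_spec (F : MvPolynomial (Fin n) K) {L : List (MvPolynomial (Fin n) K)}
    (hpos : ∀ T ∈ L, 0 < cls T) (hL : L.Pairwise fun A B => cls A < cls B) :
    (∀ T ∈ L, ∀ i : Fin n, cls T = i + 1 → (resTS F L).degreeOf i = 0) ∧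
      (∀ j, F.degreeOf j = 0 → (∀ T ∈ L, T.degreeOf j = 0) → (resTS F L).degreeOf j = 0) ∧
      resTS F L ∈ Ideal.span (insert F {T | T ∈ L}) := by
  induction L with
  | nil => exact ⟨by simp, fun j h _ => h, Ideal.subset_span (by simp [resTS])⟩
  | cons T L ih =>
    rw [List.pairwise_cons] at hL
    obtain ⟨h1, h2, h3⟩ := ih (fun S hS => hpos S (List.mem_cons_of_mem _ hS)) hL.2
    obtain ⟨i, hi⟩ := exists_cls_eq_succ (hpos T List.mem_cons_self)
    have hrec : resTS F (T :: L) = resv (resTS F L) T i := by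
      rw [← resLv_eq hi]
      rfl
    rw [hrec]
    obtain ⟨hT, hT'⟩ := cls_eq_succ_iff.1 hi
    refine ⟨fun S hS j hj => ?_, fun j hj hj' => ?_, ?_⟩
    · rcases List.mem_cons.1 hS with rfl | hS
      · have : j = i := Fin.ext (by omega)
        rw [this]
        exact degreeOf_resv_self _ _ _
      · have hij : i < j := Fin.lt_def.2 (by have := hL.1 S hS; omega)
        exact degreeOf_resv_eq_zero (h1 S hS j hj) (hT' j hij)
    · exact degreeOf_resv_eq_zero (h2 j hj fun S hS => hj' S (List.mem_cons_of_mem _ hS))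
        (hj' T List.mem_cons_self)
    · refine Ideal.span_le.2 ?_ (resv_mem_span hT (resTS F L))
      rintro S (rfl | rfl)
      · refine Ideal.span_mono (Set.insert_subset_insert ?_) h3
        exact fun S hS => List.mem_cons_of_mem _ hS
      · exact Ideal.subset_span (Set.mem_insert_of_mem _ List.mem_cons_self)

theorem resTS_ne_zero {F : MvPolynomial (Fin n) K} (hF : F ≠ 0)
    {L : List (MvPolynomial (Fin n) K)} (hpos : ∀ T ∈ L, 0 < cls T)
    (h : ∀ T ∈ L, ∀ i : Fin n, cls T = i + 1 → F.degreeOf i = 0) : resTS F L ≠ 0 := by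
  have key : ∃ e, resTS F L = F ^ e := by
    induction L with
    | nil => exact ⟨1, (pow_one F).symm⟩
    | cons T L ih =>
      obtain ⟨e, he⟩ := ih (fun S hS => hpos S (List.mem_cons_of_mem _ hS))
        (fun S hS => h S (List.mem_cons_of_mem _ hS))
      obtain ⟨i, hi⟩ := exists_cls_eq_succ (hpos T List.mem_cons_self)
      have hrec : resTS F (T :: L) = resv (resTS F L) T i := by
        rw [← resLv_eq hi]
        rfl
      refine ⟨e * T.degreeOf i, ?_⟩
      rw [hrec, he, resv_of_degreeOf_eq_zero
        (degreeOf_pow_eq_zero (h T List.mem_cons_self i hi) _), pow_mul]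
  obtain ⟨e, he⟩ := key
  rw [he]
  exact pow_ne_zero _ hF

/-! ### The lexicographical order -/

/-- The purely lexicographical order with `x_1 < ⋯ < x_n`, as a monomial order. -/
noncomputable def plexOrder (n : ℕ) : MonomialOrder (Fin n) where
  syn := Colex (Fin n →₀ ℕ)
  toSyn := { toEquiv := toColex, map_add' := toColex_add }
  toSyn_monotone := Finsupp.toColex_monotone

/-- The exponent of the leading monomial with respect to the purely lexicographical order. -/
noncomputable def plexDeg (F : MvPolynomial (Fin n) K) : Fin n →₀ ℕ :=
  (plexOrder n).degree F

theorem plexOrder_lt_iff {a b : Fin n →₀ ℕ} :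
    (plexOrder n).toSyn a < (plexOrder n).toSyn b ↔ plexLT a b := by
  change toColex a < toColex b ↔ _
  rw [Finsupp.Colex.lt_iff]
  exact exists_congr fun _ => and_comm

theorem plexLT_asymm {a b : Fin n →₀ ℕ} (h : plexLT a b) : ¬ plexLT b a := by
  rw [← plexOrder_lt_iff] at h ⊢
  exact h.not_gt

theorem plexLT_add_right {a b : Fin n →₀ ℕ} (h : plexLT a b) (c : Fin n →₀ ℕ) :
    plexLT (a + c) (b + c) := by
  obtain ⟨k, h1, h2⟩ := h
  exact ⟨k, by simpa using h1, fun j hj => by simp [h2 j hj]⟩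

theorem plexDeg_mem_support {F : MvPolynomial (Fin n) K} (hF : F ≠ 0) :
    plexDeg F ∈ F.support :=
  MonomialOrder.degree_mem_support hF

theorem plexDeg_mul {F G : MvPolynomial (Fin n) K} (hF : F ≠ 0) (hG : G ≠ 0) :
    plexDeg (F * G) = plexDeg F + plexDeg G :=
  MonomialOrder.degree_mul hF hG

theorem IsLpp.eq_plexDeg {F : MvPolynomial (Fin n) K} {m : Fin n →₀ ℕ} (h : IsLpp F m) :
    m = plexDeg F := by
  by_contra hne
  have hF : F ≠ 0 := by
    rintro rfl
    simpa using h.1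
  have h1 := h.2 _ (plexDeg_mem_support hF) (Ne.symm hne)
  rw [← plexOrder_lt_iff] at h1
  exact absurd ((plexOrder n).le_degree h.1) h1.not_ge

theorem plexDeg_apply_le (F : MvPolynomial (Fin n) K) (j : Fin n) :
    plexDeg F j ≤ F.degreeOf j := by
  by_cases hF : F = 0
  · simp [hF, plexDeg]
  · exact monomial_le_degreeOf j (plexDeg_mem_support hF)

theorem plexDeg_apply_eq_degreeOf {F : MvPolynomial (Fin n) K} {i : Fin n}
    (h : ∀ j, i < j → F.degreeOf j = 0) : plexDeg F i = F.degreeOf i := by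
  refine le_antisymm (plexDeg_apply_le F i) ?_
  by_cases hF : F = 0
  · simp [hF]
  obtain ⟨m, hm, hmi⟩ := exists_mem_support_eq_degreeOf (i := i) hF
  rw [← hmi]
  by_contra hlt
  have h1 : plexLT (plexDeg F) m := ⟨i, not_le.1 hlt, fun j hj => by
    have h1 := plexDeg_apply_le F j
    have h2 := monomial_le_degreeOf j hm
    rw [h j hj] at h1 h2
    omega⟩
  rw [← plexOrder_lt_iff] at h1
  exact absurd ((plexOrder n).le_degree hm) h1.not_ge

theorem plexLT_plexDeg_of_degreeOf_lt {A B : MvPolynomial (Fin n) K} {i : Fin n}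
    (hA : ∀ j, i < j → A.degreeOf j = 0) (hB : ∀ j, i < j → B.degreeOf j = 0)
    (h : B.degreeOf i < A.degreeOf i) : plexLT (plexDeg B) (plexDeg A) := by
  refine ⟨i, ?_, fun j hj => ?_⟩
  · rwa [plexDeg_apply_eq_degreeOf hA, plexDeg_apply_eq_degreeOf hB]
  · have h1 := plexDeg_apply_le A j
    have h2 := plexDeg_apply_le B j
    rw [hA j hj] at h1
    rw [hB j hj] at h2
    omega

theorem plexDeg_mul_X_pow_add {A B : MvPolynomial (Fin n) K} {i : Fin n} {d : ℕ} (hA0 : A ≠ 0)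
    (hA : ∀ j, i ≤ j → A.degreeOf j = 0) (hB : ∀ j, i < j → B.degreeOf j = 0)
    (hd : B.degreeOf i < d) :
    A * X i ^ d + B ≠ 0 ∧ plexDeg (A * X i ^ d + B) = plexDeg A + Finsupp.single i d := by
  have hX : (X i : MvPolynomial (Fin n) K) ^ d ≠ 0 := pow_ne_zero _ (X_ne_zero i)
  have hAX := mul_ne_zero hA0 hX
  have hdeg : plexDeg (A * X i ^ d) = plexDeg A + Finsupp.single i d := by
    rw [plexDeg_mul hA0 hX]
    congr 1
    rw [X_pow_eq_monomial]
    classical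
    exact ((plexOrder n).degree_monomial _).trans (if_neg one_ne_zero)
  have hlt : plexLT (plexDeg B) (plexDeg (A * X i ^ d)) := by
    refine plexLT_plexDeg_of_degreeOf_lt (fun j hj => ?_) hB ?_
    · exact degreeOf_mul_eq_zero (hA j hj.le)
        (degreeOf_pow_eq_zero (degreeOf_X_of_ne hj.ne') _)
    · rw [degreeOf_mul_eq hA0 hX, degreeOf_X_self_pow]
      omega
  have hadd : plexDeg (A * X i ^ d + B) = plexDeg (A * X i ^ d) :=
    MonomialOrder.degree_add_of_lt (plexOrder_lt_iff.2 hlt)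
  refine ⟨fun h0 => ?_, hadd.trans hdeg⟩
  rw [h0] at hadd
  have h1 : plexDeg (0 : MvPolynomial (Fin n) K) = 0 := MonomialOrder.degree_zero
  obtain ⟨k, hk, -⟩ := hlt
  rw [← hadd, h1] at hk
  simp at hk

/-! ### Ideals generated by polynomials in fewer variables -/

theorem coefv_mem_span {i : Fin n} {S : Set (MvPolynomial (Fin n) K)}
    (hS : ∀ s ∈ S, s.degreeOf i = 0) {P : MvPolynomial (Fin n) K} (hP : P ∈ Ideal.span S)
    (d : ℕ) : coefv i d P ∈ Ideal.span S := by
  suffices h : ∀ a, coefv i d (a * P) ∈ Ideal.span S by simpa using h 1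
  induction hP using Submodule.span_induction with
  | mem s hs =>
    intro a
    rw [mul_comm, coefv_mul_left d (hS s hs), mul_comm]
    exact Ideal.mul_mem_left _ _ (Ideal.subset_span hs)
  | zero =>
    intro a
    rw [mul_zero, show coefv i d (0 : MvPolynomial (Fin n) K) = 0 by simp [coefv]]
    exact zero_mem _
  | add x y _ _ hx hy =>
    intro a
    rw [mul_add, coefv_add]
    exact add_mem (hx a) (hy a)
  | smul b x _ hx =>
    intro a
    rw [smul_eq_mul, ← mul_assoc]
    exact hx _

/-- The endomorphism sending all variables `x_j` with `i ≤ j` to zero. -/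
noncomputable def killGE (i : Fin n) :
    MvPolynomial (Fin n) K →ₐ[K] MvPolynomial (Fin n) K :=
  aeval fun j => if j < i then X j else 0

theorem killGE_eq_self {i : Fin n} {F : MvPolynomial (Fin n) K}
    (h : ∀ j, i ≤ j → F.degreeOf j = 0) : killGE i F = F := by
  conv_rhs => rw [← aeval_X_left_apply F]
  refine eval₂Hom_congr' rfl (fun j hj _ => ?_) rfl
  rw [if_pos]
  by_contra hij
  have := mem_vars_iff_degreeOf_pos.1 hj
  rw [h j (not_lt.1 hij)] at this
  omega

theorem degreeOf_killGE {i j : Fin n} (hij : i ≤ j) (F : MvPolynomial (Fin n) K) :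
    (killGE i F).degreeOf j = 0 := by
  induction F using MvPolynomial.induction_on with
  | C a => simp [killGE, algebraMap_eq]
  | add p q hp hq =>
    rw [map_add]
    exact Nat.le_zero.1 ((degreeOf_add_le _ _ _).trans (by simp [hp, hq]))
  | mul_X p k hp =>
    rw [map_mul]
    refine degreeOf_mul_eq_zero hp ?_
    rw [killGE, aeval_X]
    split_ifs with hk
    · exact degreeOf_X_of_ne (hk.trans_le hij).ne'
    · exact degreeOf_zero _

/-- A member of an ideal generated by `A` and polynomials in the variables below `x_i`, itself
only involving these variables, is a combination in which the coefficient of `A` only involves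
these variables. -/
theorem exists_mul_sub_mem_span {i : Fin n} {A R : MvPolynomial (Fin n) K}
    {S : Set (MvPolynomial (Fin n) K)} (hA : ∀ j, i ≤ j → A.degreeOf j = 0)
    (hS : ∀ s ∈ S, ∀ j, i ≤ j → s.degreeOf j = 0) (hR : ∀ j, i ≤ j → R.degreeOf j = 0)
    (h : R ∈ Ideal.span (insert A S)) :
    ∃ B, (∀ j, i ≤ j → B.degreeOf j = 0) ∧ R - B * A ∈ Ideal.span S := by
  obtain ⟨B, s, hs, hBs⟩ := Ideal.mem_span_insert.1 h
  refine ⟨killGE i B, fun j hj => degreeOf_killGE hj B, ?_⟩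
  have hs' : killGE i s ∈ Ideal.span S := by
    have := Ideal.mem_map_of_mem (killGE (K := K) i) hs
    rw [Ideal.map_span] at this
    refine Ideal.span_mono ?_ this
    rintro _ ⟨t, ht, rfl⟩
    rwa [killGE_eq_self (hS t ht)]
  have h1 := congrArg (killGE i) hBs
  rw [map_add, map_mul, killGE_eq_self hA, killGE_eq_self hR] at h1
  rwa [h1, add_sub_cancel_left]

/-! ### W-characteristic sets with respect to their leading variables -/

/-- `C 0, …, C (r - 1)` is a triangular sequence in the ideal `J` with leading variables
`x_{y 0} < ⋯ < x_{y (r - 1)}`, no variable outside of this list lies above `x_{y 0}`, and every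
nonzero member of `J` has a leading monomial of degree at least `deg(C i, x_{y i})` in `x_{y i}`
and not below that of `C i`, for some `i`. -/
structure IsPlexTriangular (J : Ideal (MvPolynomial (Fin n) K)) (r : ℕ)
    (C : ℕ → MvPolynomial (Fin n) K) (y : ℕ → Fin n) : Prop where
  cls_eq : ∀ i < r, cls (C i) = y i + 1
  lt : ∀ i j, i < j → j < r → y i < y j
  exists_eq : ∀ i < r, ∀ v, y i ≤ v → ∃ j < r, y j = v
  mem : ∀ i < r, C i ∈ J
  lead : ∀ F ∈ J, F ≠ 0 → ∃ i < r, (C i).degreeOf (y i) ≤ plexDeg F (y i) ∧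
    ¬ plexLT (plexDeg F) (plexDeg (C i))

theorem ne_zero_of_mem_closure_ini {L : List (MvPolynomial (Fin n) K)} (hpos : ∀ T ∈ L, 0 < cls T)
    {h : MvPolynomial (Fin n) K} (hh : h ∈ Submonoid.closure {I | ∃ T ∈ L, I = ini T}) :
    h ≠ 0 := by
  induction hh using Submonoid.closure_induction with
  | mem x hx =>
    obtain ⟨T, hT, rfl⟩ := hx
    obtain ⟨i, hi⟩ := exists_cls_eq_succ (hpos T hT)
    exact ini_ne_zero hi
  | one => exact one_ne_zero
  | mul x z _ _ hx hz => exact mul_ne_zero hx hz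

theorem degreeOf_eq_zero_of_mem_closure_ini {L : List (MvPolynomial (Fin n) K)} {v : Fin n}
    (hL : ∀ T ∈ L, (ini T).degreeOf v = 0) {h : MvPolynomial (Fin n) K}
    (hh : h ∈ Submonoid.closure {I | ∃ T ∈ L, I = ini T}) : h.degreeOf v = 0 := by
  induction hh using Submonoid.closure_induction with
  | mem x hx =>
    obtain ⟨T, hT, rfl⟩ := hx
    exact hL T hT
  | one => exact degreeOf_one v
  | mul x z _ _ hx hz => exact degreeOf_mul_eq_zero hx hz

theorem degreeOf_ini_le {T : MvPolynomial (Fin n) K} (hT : 0 < cls T) (v : Fin n) :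
    (ini T).degreeOf v ≤ T.degreeOf v := by
  obtain ⟨i, hi⟩ := exists_cls_eq_succ hT
  rw [ini_eq hi]
  exact degreeOf_coefv_le _ _ _ _

namespace IsPlexTriangular

variable {J : Ideal (MvPolynomial (Fin n) K)} {r : ℕ} {C : ℕ → MvPolynomial (Fin n) K}
  {y : ℕ → Fin n}

theorem degreeOf_pos (hC : IsPlexTriangular J r C y) {i : ℕ} (hi : i < r) :
    0 < (C i).degreeOf (y i) :=
  (cls_eq_succ_iff.1 (hC.cls_eq i hi)).1

theorem degreeOf_eq_zero (hC : IsPlexTriangular J r C y) {i : ℕ} (hi : i < r) {v : Fin n}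
    (hv : y i < v) : (C i).degreeOf v = 0 :=
  (cls_eq_succ_iff.1 (hC.cls_eq i hi)).2 v hv

theorem degreeOf_ini_eq_zero_of_le (hC : IsPlexTriangular J r C y) {i : ℕ} (hi : i < r)
    {v : Fin n} (hv : y i ≤ v) : (ini (C i)).degreeOf v = 0 :=
  degreeOf_ini_eq_zero (hC.cls_eq i hi) hv

theorem ini_eq_lcv (hC : IsPlexTriangular J r C y) {i : ℕ} (hi : i < r) :
    ini (C i) = lcv (y i) (C i) :=
  ini_eq (hC.cls_eq i hi)

theorem lt_of_lt (hC : IsPlexTriangular J r C y) {i j : ℕ} (hi : i < r) (h : y i < y j) :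
    i < j := by
  by_contra hij
  rcases (not_lt.1 hij).eq_or_lt with rfl | hji
  · exact lt_irrefl _ h
  · exact lt_asymm h (hC.lt j i hji hi)

theorem span_le (hC : IsPlexTriangular J r C y) {k : ℕ} (hk : k ≤ r) :
    Ideal.span (C '' Set.Iio k) ≤ J := by
  refine Ideal.span_le.2 ?_
  rintro _ ⟨i, hi, rfl⟩
  exact hC.mem i (lt_of_lt_of_le hi hk)

theorem cls_pos_of_mem (hC : IsPlexTriangular J r C y) {a m : ℕ} (h : a + m ≤ r) :
    ∀ T ∈ (List.range' a m).map C, 0 < cls T := by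
  simp only [List.mem_map, List.mem_range'_1]
  rintro _ ⟨i, hi, rfl⟩
  rw [hC.cls_eq i (by omega)]
  omega

theorem pairwise_cls (hC : IsPlexTriangular J r C y) {a m : ℕ} (h : a + m ≤ r) :
    ((List.range' a m).map C).Pairwise fun A B => cls A < cls B := by
  rw [List.pairwise_map]
  refine List.Pairwise.imp_of_mem ?_ List.pairwise_lt_range'
  intro i j hi hj hij
  rw [List.mem_range'_1] at hi hj
  rw [hC.cls_eq i (by omega), hC.cls_eq j (by omega)]
  have := hC.lt i j hij (by omega)
  omega

theorem eq_zero_of_mul_mem (hC : IsPlexTriangular J r C y) {W H : MvPolynomial (Fin n) K}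
    (hW : W ≠ 0) (hWH : W * H ∈ J)
    (h : ∀ i < r, H.degreeOf (y i) + plexDeg W (y i) < (C i).degreeOf (y i)) : H = 0 := by
  by_contra hH
  obtain ⟨i, hi, h1, -⟩ := hC.lead _ hWH (mul_ne_zero hW hH)
  rw [plexDeg_mul hW hH, Finsupp.add_apply] at h1
  have := h i hi
  have := plexDeg_apply_le H (y i)
  omega

/-- A reduced element of the ideal generated by `ini (C k)` and the preceding `C i` whose leading
monomial is below that of `ini (C k)` vanishes. -/
theorem eq_zero_of_plexLT_ini (hC : IsPlexTriangular J r C y) {k : ℕ} (hk : k < r)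
    {R : MvPolynomial (Fin n) K} (hR : R ∈ Ideal.span (insert (ini (C k)) (C '' Set.Iio k)))
    (hR0 : ∀ v, y k ≤ v → R.degreeOf v = 0)
    (hRi : ∀ i < k, R.degreeOf (y i) < (C i).degreeOf (y i))
    (hlt : plexLT (plexDeg R) (plexDeg (ini (C k)))) : R = 0 := by
  by_contra hne
  have hini := hC.ini_eq_lcv hk
  have hI : ∀ v, y k ≤ v → (ini (C k)).degreeOf v = 0 :=
    fun v hv => hC.degreeOf_ini_eq_zero_of_le hk hv
  obtain ⟨B, hB, hRB⟩ := exists_mul_sub_mem_span hI (by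
    rintro _ ⟨i, hi, rfl⟩ v hv
    exact hC.degreeOf_eq_zero (lt_trans hi hk) ((hC.lt i k hi hk).trans_le hv)) hR0 hR
  set d := (C k).degreeOf (y k) with hd
  set U := C k - ini (C k) * X (y k) ^ d with hU
  have hUd : U.degreeOf (y k) < d := by
    rw [hU, hini]
    exact degreeOf_sub_lcv_mul_lt (hC.degreeOf_pos hk)
  have hU0 : ∀ v, y k < v → U.degreeOf v = 0 := fun v hv =>
    degreeOf_sub_eq_zero (hC.degreeOf_eq_zero hk hv)
      (degreeOf_mul_eq_zero (hI v hv.le) (degreeOf_pow_eq_zero (degreeOf_X_of_ne hv.ne') _))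
  obtain ⟨-, hCdeg⟩ := plexDeg_mul_X_pow_add (ini_ne_zero (hC.cls_eq k hk)) hI hU0 hUd
  rw [show ini (C k) * X (y k) ^ d + U = C k by rw [hU]; ring] at hCdeg
  have hBU0 : ∀ v, y k < v → (B * U).degreeOf v = 0 := fun v hv =>
    degreeOf_mul_eq_zero (hB v hv.le) (hU0 v hv)
  obtain ⟨hF0, hFdeg⟩ := plexDeg_mul_X_pow_add hne hR0 hBU0
    ((degreeOf_mul_le_of_left (hB _ le_rfl) U).trans_lt hUd)
  have hFJ : R * X (y k) ^ d + B * U ∈ J := by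
    have h1 : R * X (y k) ^ d + B * U =
        X (y k) ^ d * (R - B * ini (C k)) + B * C k := by
      rw [hU]
      ring
    rw [h1]
    exact add_mem (Ideal.mul_mem_left _ _ (hC.span_le hk.le hRB))
      (Ideal.mul_mem_left _ _ (hC.mem k hk))
  obtain ⟨i, hi, h1, h2⟩ := hC.lead _ hFJ hF0
  rw [hFdeg] at h1 h2
  rcases lt_trichotomy i k with hik | rfl | hki
  · have h3 := hRi i hik
    have h4 := plexDeg_apply_le R (y i)
    rw [Finsupp.add_apply, Finsupp.single_eq_of_ne (hC.lt i k hik hk).ne] at h1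
    omega
  · rw [hCdeg] at h2
    exact h2 (plexLT_add_right hlt _)
  · have h3 := hC.lt k i hki hi
    have h4 := plexDeg_apply_le R (y i)
    have h5 := hC.degreeOf_pos hi
    rw [hR0 _ h3.le] at h4
    rw [Finsupp.add_apply, Finsupp.single_eq_of_ne h3.ne'] at h1
    omega

theorem premTS_eq_zero_of_mul_ini_mem (hC : IsPlexTriangular J r C y) {k : ℕ} (hk : k < r)
    {W : MvPolynomial (Fin n) K} (hW : W ≠ 0) (hWI : W * ini (C k) ∈ J)
    {L : List (MvPolynomial (Fin n) K)} (hpos : ∀ T ∈ L, 0 < cls T)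
    (hL : L.Pairwise fun A B => cls A < cls B)
    (hLmem : ∀ T ∈ L, T ∈ insert (ini (C k)) (C '' Set.Iio k))
    (hWk : ∀ i, k ≤ i → i < r → plexDeg W (y i) = 0)
    (hR : ∀ i < k, (premTS (C k) L).degreeOf (y i) + plexDeg W (y i) < (C i).degreeOf (y i)) :
    premTS (C k) L = 0 := by
  have hfree : ∀ T ∈ L, ∀ v, y k ≤ v → T.degreeOf v = 0 := by
    intro T hT v hv
    rcases hLmem T hT with rfl | ⟨i, hi, rfl⟩
    · exact hC.degreeOf_ini_eq_zero_of_le hk hv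
    · exact hC.degreeOf_eq_zero (lt_trans hi hk) ((hC.lt i k hi hk).trans_le hv)
  obtain ⟨-, hdeg, h, hh, hmem⟩ := premTS_spec (C k) hpos hL
  set R := premTS (C k) L
  set d := (C k).degreeOf (y k) with hd
  have hhk : h.degreeOf (y k) = 0 := degreeOf_eq_zero_of_mem_closure_ini (fun T hT =>
    Nat.le_zero.1 ((degreeOf_ini_le (hpos T hT) _).trans (hfree T hT _ le_rfl).le)) hh
  have hsub : Ideal.span {T | T ∈ L} ≤ Ideal.span (insert (ini (C k)) (C '' Set.Iio k)) :=
    Ideal.span_mono hLmem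
  have hmulJ : ∀ H ∈ Ideal.span (insert (ini (C k)) (C '' Set.Iio k)), W * H ∈ J := by
    intro H hH
    obtain ⟨B, s, hs, rfl⟩ := Ideal.mem_span_insert.1 hH
    rw [mul_add, mul_left_comm]
    exact add_mem (Ideal.mul_mem_left _ _ hWI) (Ideal.mul_mem_left _ _ (hC.span_le hk.le hs))
  have hRgt : ∀ v, y k < v → R.degreeOf v = 0 := fun v hv =>
    Nat.le_zero.1 ((hdeg v fun T hT => hfree T hT v hv.le).trans (hC.degreeOf_eq_zero hk hv).le)
  have hRd : coefv (y k) d R = 0 := by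
    refine hC.eq_zero_of_mul_mem hW (hmulJ _ ?_) fun i hi => ?_
    · have h1 := hsub (coefv_mem_span (fun T hT => hfree T hT _ le_rfl) hmem d)
      rw [coefv_sub, coefv_mul_left d hhk] at h1
      have h2 : h * coefv (y k) d (C k) ∈ Ideal.span (insert (ini (C k)) (C '' Set.Iio k)) := by
        refine Ideal.mul_mem_left _ _ (Ideal.subset_span (Or.inl ?_))
        rw [hC.ini_eq_lcv hk, lcv]
      simpa using sub_mem h2 h1
    · have h1 := degreeOf_coefv_le (y k) (y i) d R
      have h2 := hC.degreeOf_pos hi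
      rcases lt_trichotomy i k with hik | rfl | hki
      · have := hR i hik
        omega
      · rw [degreeOf_coefv_self, hWk i le_rfl hi]
        omega
      · rw [hRgt _ (hC.lt k i hki hi)] at h1
        rw [hWk i hki.le hi]
        omega
  by_contra hne
  have hRk : R.degreeOf (y k) < d := by
    refine lt_of_le_of_ne (hdeg _ fun T hT => hfree T hT _ le_rfl) fun heq => ?_
    rw [← heq] at hRd
    exact lcv_ne_zero hne hRd
  refine hne (hC.eq_zero_of_mul_mem hW ?_ fun i hi => ?_)
  · have h1 : W * R = W * h * C k - W * (h * C k - R) := by ring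
    rw [h1]
    exact sub_mem (Ideal.mul_mem_left _ _ (hC.mem k hk)) (hmulJ _ (hsub hmem))
  · rcases lt_trichotomy i k with hik | rfl | hki
    · exact hR i hik
    · rw [hWk i le_rfl hi]
      exact hRk
    · rw [hWk i hki.le hi, hRgt _ (hC.lt k i hki hi)]
      exact hC.degreeOf_pos hi

/-- The initial of the first polynomial violating normality is not regular. -/
theorem resTS_ini_eq_zero (hC : IsPlexTriangular J r C y) {k : ℕ} (hk : k < r)
    (h : ∃ i < k, (ini (C k)).degreeOf (y i) ≠ 0) :
    resTS (ini (C k)) ((List.range' 0 k).map C) = 0 := by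
  obtain ⟨i, hi, hik⟩ := h
  have hIk : ∀ v, y k ≤ v → (ini (C k)).degreeOf v = 0 :=
    fun v hv => hC.degreeOf_ini_eq_zero_of_le hk hv
  have hpos : 0 < cls (ini (C k)) := lt_of_lt_of_le (Nat.succ_pos _) (Finset.le_sup
    (f := fun i : Fin n => (i : ℕ) + 1) (mem_vars_iff_degreeOf_pos.2 (Nat.pos_of_ne_zero hik)))
  obtain ⟨v, hv⟩ := exists_cls_eq_succ hpos
  obtain ⟨hv0, hv1⟩ := cls_eq_succ_iff.1 hv
  have hiv : y i ≤ v := not_lt.1 fun hlt => hik (hv1 _ hlt)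
  have hvk : v < y k := not_le.1 fun hle => hv0.ne' (hIk v hle)
  obtain ⟨h1, h2, h3⟩ := resTS_spec (ini (C k)) (hC.cls_pos_of_mem (a := 0) (m := k) (by omega))
    (hC.pairwise_cls (by omega))
  have hy : ∀ j < k, (resTS (ini (C k)) ((List.range' 0 k).map C)).degreeOf (y j) = 0 :=
    fun j hj => h1 (C j) (List.mem_map_of_mem (List.mem_range'_1.2 (by omega))) (y j)
      (hC.cls_eq j (hj.trans hk))
  have hge : ∀ w, y k ≤ w → (resTS (ini (C k)) ((List.range' 0 k).map C)).degreeOf w = 0 := by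
    refine fun w hw => h2 w (hIk w hw) fun T hT => ?_
    obtain ⟨j, hj, rfl⟩ := List.mem_map.1 hT
    rw [List.mem_range'_1] at hj
    exact hC.degreeOf_eq_zero (by omega) ((hC.lt j k (by omega) hk).trans_le hw)
  have hall : ∀ w, v ≤ w → (resTS (ini (C k)) ((List.range' 0 k).map C)).degreeOf w = 0 := by
    intro w hw
    obtain ⟨j, hj, rfl⟩ := hC.exists_eq i (hi.trans hk) w (hiv.trans hw)
    by_cases hjk : j < k
    · exact hy j hjk
    · refine hge _ ?_
      rcases (not_lt.1 hjk).eq_or_lt with rfl | hlt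
      · exact le_rfl
      · exact (hC.lt k j hlt hj).le
  refine hC.eq_zero_of_plexLT_ini hk (Ideal.span_mono (Set.insert_subset_insert ?_) h3) hge
    (fun j hj => ?_) (plexLT_plexDeg_of_degreeOf_lt hv1 (fun w hw => hall w hw.le) ?_)
  · intro T hT
    obtain ⟨j, hj, rfl⟩ := List.mem_map.1 hT
    rw [List.mem_range'_1] at hj
    exact ⟨j, Set.mem_Iio.2 (by omega), rfl⟩
  · rw [hy j hj]
    exact hC.degreeOf_pos (hj.trans hk)
  · rw [hall v le_rfl]
    exact hv0

theorem mem_image_of_mem_map_range' {a m k : ℕ} (h : a + m ≤ k) {T : MvPolynomial (Fin n) K}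
    (hT : T ∈ (List.range' a m).map C) : T ∈ C '' Set.Iio k := by
  obtain ⟨i, hi, rfl⟩ := List.mem_map.1 hT
  rw [List.mem_range'_1] at hi
  exact ⟨i, Set.mem_Iio.2 (by omega), rfl⟩

theorem degreeOf_eq_zero_of_mem_map_range' (hC : IsPlexTriangular J r C y) {a m : ℕ}
    (h : a + m ≤ r) {v : Fin n} (hv : ∀ i, a ≤ i → i < a + m → y i < v)
    {T : MvPolynomial (Fin n) K} (hT : T ∈ (List.range' a m).map C) : T.degreeOf v = 0 := by
  obtain ⟨i, hi, rfl⟩ := List.mem_map.1 hT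
  rw [List.mem_range'_1] at hi
  exact hC.degreeOf_eq_zero (by omega) (hv i hi.1 hi.2)

/-- If the initial of `C k` is not reduced with respect to the polynomial `C l` having the same
leading variable, it is pseudo-divisible by `C 0, …, C l`, and `C k` by `C 0, …, C (k - 1)`. -/
theorem premTS_eq_zero_of_le (hC : IsPlexTriangular J r C y) {k l : ℕ} (hk : k < r) (hlk : l < k)
    (hinis : ∀ i < k, ∀ j < r, (ini (C i)).degreeOf (y j) = 0)
    (hcls : cls (ini (C k)) = y l + 1)
    (hle : (C l).degreeOf (y l) ≤ (ini (C k)).degreeOf (y l)) :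
    premTS (ini (C k)) ((List.range' 0 (l + 1)).map C) = 0 ∧
      premTS (C k) ((List.range' 0 k).map C) = 0 := by
  obtain ⟨-, hI⟩ := cls_eq_succ_iff.1 hcls
  have hIk : ∀ v, y k ≤ v → (ini (C k)).degreeOf v = 0 :=
    fun v hv => hC.degreeOf_ini_eq_zero_of_le hk hv
  have hpos := hC.cls_pos_of_mem (a := 0) (m := l + 1) (by omega)
  obtain ⟨h1, h2, h, hh, hmem⟩ := premTS_spec (ini (C k)) hpos (hC.pairwise_cls (by omega))
  set R := premTS (ini (C k)) ((List.range' 0 (l + 1)).map C) with hRdef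
  have hred : ∀ i ≤ l, R.degreeOf (y i) < (C i).degreeOf (y i) := fun i hi =>
    h1 (C i) (List.mem_map_of_mem (List.mem_range'_1.2 (by omega))) _ (hC.cls_eq i (by omega))
  have hgt : ∀ v, y l < v → R.degreeOf v = 0 := by
    refine fun v hv => Nat.le_zero.1 ((h2 v fun T hT => ?_).trans (hI v hv).le)
    refine hC.degreeOf_eq_zero_of_mem_map_range' (by omega) (fun i _ hi => ?_) hT
    rcases (Nat.lt_succ_iff.1 (by omega : i < l + 1)).eq_or_lt with rfl | hil
    · exact hv
    · exact (hC.lt i l hil (by omega)).trans hv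
  have hsub : Ideal.span {T | T ∈ (List.range' 0 (l + 1)).map C} ≤
      Ideal.span (C '' Set.Iio k) :=
    Ideal.span_mono fun T hT => mem_image_of_mem_map_range' (by omega) hT
  have hR : R = 0 := by
    refine hC.eq_zero_of_plexLT_ini hk ?_ (fun v hv => hgt v ((hC.lt l k hlk hk).trans_le hv))
      (fun i hi => ?_) (plexLT_plexDeg_of_degreeOf_lt hI hgt ((hred l le_rfl).trans_le hle))
    · rw [← sub_sub_cancel (h * ini (C k)) R]
      exact sub_mem (Ideal.mul_mem_left _ _ (Ideal.subset_span (Set.mem_insert _ _)))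
        (Ideal.span_mono (Set.subset_insert _ _) (hsub hmem))
    · by_cases hil : i ≤ l
      · exact hred i hil
      · rw [hgt _ (hC.lt l i (by omega) (by omega))]
        exact hC.degreeOf_pos (by omega)
  refine ⟨hR, ?_⟩
  rw [hR, sub_zero] at hmem
  have hWy : ∀ j < r, plexDeg h (y j) = 0 := fun j hj => by
    refine Nat.le_zero.1 ((plexDeg_apply_le _ _).trans ?_)
    refine (degreeOf_eq_zero_of_mem_closure_ini (fun T hT => ?_) hh).le
    obtain ⟨i, hi, rfl⟩ := mem_image_of_mem_map_range' (k := k) (by omega) hT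
    exact hinis i hi j hj
  have hpk := hC.cls_pos_of_mem (a := 0) (m := k) (by omega)
  have hwk := hC.pairwise_cls (a := 0) (m := k) (by omega)
  refine hC.premTS_eq_zero_of_mul_ini_mem hk (ne_zero_of_mem_closure_ini hpos hh)
    (hC.span_le hk.le (hsub hmem)) hpk hwk
    (fun T hT => Or.inr (mem_image_of_mem_map_range' (by omega) hT))
    (fun i _ hi => hWy i hi) fun i hi => ?_
  rw [hWy i (hi.trans hk), add_zero]
  exact (premTS_spec (C k) hpk hwk).1 (C i) (List.mem_map_of_mem (List.mem_range'_1.2 (by omega)))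
    _ (hC.cls_eq i (by omega))

theorem pairwise_cls_append_ini (hC : IsPlexTriangular J r C y) {k l : ℕ} (hl : l < r)
    (hcls : cls (ini (C k)) = y l + 1) :
    ((List.range' 0 l).map C ++ [ini (C k)]).Pairwise fun A B => cls A < cls B := by
  refine List.pairwise_append.2 ⟨hC.pairwise_cls (by omega), List.pairwise_singleton _ _, ?_⟩
  intro A hA B hB
  obtain ⟨i, hi, rfl⟩ := mem_image_of_mem_map_range' (k := l) (by omega) hA
  rw [List.mem_singleton.1 hB, hcls, hC.cls_eq i (lt_trans hi hl)]
  have := hC.lt i l hi hl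
  omega

theorem cls_pos_append_ini (hC : IsPlexTriangular J r C y) {k l : ℕ} (hl : l < r)
    (hcls : cls (ini (C k)) = y l + 1) :
    ∀ T ∈ (List.range' 0 l).map C ++ [ini (C k)], 0 < cls T := by
  intro T hT
  rcases List.mem_append.1 hT with hT | hT
  · exact hC.cls_pos_of_mem (by omega) T hT
  · rw [List.mem_singleton.1 hT, hcls]
    omega

/-- If the initial of `C k` is reduced with respect to the polynomial `C l` having the same
leading variable, then `C l` is pseudo-divisible by `C 0, …, C (l - 1)` and this initial. -/
theorem premTS_append_ini_eq_zero (hC : IsPlexTriangular J r C y) {k l : ℕ} (hk : k < r)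
    (hlk : l < k) (hcls : cls (ini (C k)) = y l + 1)
    (hlt : (ini (C k)).degreeOf (y l) < (C l).degreeOf (y l)) :
    premTS (C l) ((List.range' 0 l).map C ++ [ini (C k)]) = 0 := by
  obtain ⟨-, hI⟩ := cls_eq_succ_iff.1 hcls
  have hl := hlk.trans hk
  obtain ⟨h1, h2, h, -, hmem⟩ := premTS_spec (C l) (hC.cls_pos_append_ini hl hcls)
    (hC.pairwise_cls_append_ini hl hcls)
  set R := premTS (C l) ((List.range' 0 l).map C ++ [ini (C k)]) with hRdef
  have hRl : R.degreeOf (y l) < (ini (C k)).degreeOf (y l) := h1 _ (by simp) _ hcls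
  have hgt : ∀ v, y l < v → R.degreeOf v = 0 := by
    refine fun v hv => Nat.le_zero.1 ((h2 v fun T hT => ?_).trans (hC.degreeOf_eq_zero hl hv).le)
    rcases List.mem_append.1 hT with hT | hT
    · exact hC.degreeOf_eq_zero_of_mem_map_range' (by omega)
        (fun i _ hi => (hC.lt i l (by omega) hl).trans hv) hT
    · rw [List.mem_singleton.1 hT]
      exact hI v hv
  refine hC.eq_zero_of_plexLT_ini hk ?_ (fun v hv => hgt v ((hC.lt l k hlk hk).trans_le hv))
    (fun i hi => ?_) (plexLT_plexDeg_of_degreeOf_lt hI hgt hRl)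
  · rw [← sub_sub_cancel (h * C l) R]
    refine sub_mem (Ideal.mul_mem_left _ _ (Ideal.subset_span (Or.inr ⟨l, hlk, rfl⟩)))
      (Ideal.span_mono (fun T hT => ?_) hmem)
    rcases List.mem_append.1 hT with hT | hT
    · exact Or.inr (mem_image_of_mem_map_range' (by omega) hT)
    · exact Or.inl (List.mem_singleton.1 hT)
  · rcases lt_trichotomy i l with hil | rfl | hli
    · exact h1 (C i) (List.mem_append_left _ (List.mem_map_of_mem
        (List.mem_range'_1.2 (by omega)))) _ (hC.cls_eq i (by omega))
    · exact hRl.trans hlt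
    · rw [hgt _ (hC.lt l i hli (by omega))]
      exact hC.degreeOf_pos (by omega)

/-- If moreover the initial of the initial of `C k` is regular with respect to `C 0, …, C (l - 1)`,
some multiple of it with a leading monomial of degree
`deg (C l) - deg (ini (C k))` in `x_{y l}` and free of the other leading variables times the
initial of `C k` lies in the ideal. -/
theorem exists_mul_ini_mem (hC : IsPlexTriangular J r C y) {k l : ℕ} (hk : k < r) (hlk : l < k)
    (hinis : ∀ i < k, ∀ j < r, (ini (C i)).degreeOf (y j) = 0)
    (hcls : cls (ini (C k)) = y l + 1)
    (hlt : (ini (C k)).degreeOf (y l) < (C l).degreeOf (y l))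
    (hres : resTS (ini (ini (C k))) ((List.range' 0 l).map C) ≠ 0) :
    ∃ W ≠ 0, W * ini (C k) ∈ J ∧
      plexDeg W (y l) + (ini (C k)).degreeOf (y l) = (C l).degreeOf (y l) ∧
      ∀ i < r, i ≠ l → plexDeg W (y i) = 0 := by
  have hl := hlk.trans hk
  have hprem := hC.premTS_append_ini_eq_zero hk hlk hcls hlt
  obtain ⟨hIpos, hI⟩ := cls_eq_succ_iff.1 hcls
  have hI0 := ne_zero_of_cls_eq_succ hcls
  have hge : ∀ v, y l ≤ v → ∃ j < r, y j = v := fun v hv => hC.exists_eq l hl v hv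
  have hpos := hC.cls_pos_of_mem (a := 0) (m := l) (by omega)
  have hpw := hC.pairwise_cls (a := 0) (m := l) (by omega)
  have hsub : Ideal.span {T | T ∈ (List.range' 0 l).map C} ≤ Ideal.span (C '' Set.Iio l) :=
    Ideal.span_mono fun T hT => mem_image_of_mem_map_range' (by omega) hT
  have hspanJ := hC.span_le hl.le
  -- the pseudo-division of `C l` by the initial
  obtain ⟨g1, ⟨q, Q, g2⟩, g3⟩ := prem_spec hIpos (C l)
  set I := ini (C k) with hIdef
  set R := prem (C l) I (y l) with hR
  have ha : ini I = lcv (y l) I := ini_eq hcls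
  rw [← ha] at g2
  set a := ini I with hadef
  have ha0 : a ≠ 0 := ini_ne_zero hcls
  have hav : ∀ v, y l ≤ v → a.degreeOf v = 0 := fun v hv => degreeOf_ini_eq_zero hcls hv
  have hRgt : ∀ v, y l < v → R.degreeOf v = 0 := fun v hv =>
    Nat.le_zero.1 ((g3 v (hI v hv)).trans (hC.degreeOf_eq_zero hl hv).le)
  have hpremR : premTS R ((List.range' 0 l).map C) = 0 := by
    rw [← hprem, hR, ← premLv_eq hcls, premTS, premTS, List.foldr_append]
    rfl
  obtain ⟨-, -, h, hh, hmem⟩ := premTS_spec R hpos hpw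
  rw [hpremR, sub_zero] at hmem
  have hh0 := ne_zero_of_mem_closure_ini hpos hh
  have hhy : ∀ j < r, h.degreeOf (y j) = 0 := fun j hj =>
    degreeOf_eq_zero_of_mem_closure_ini (fun T hT => by
      obtain ⟨i, hi, rfl⟩ := mem_image_of_mem_map_range' (k := k) (by omega) hT
      exact hinis i hi j hj) hh
  have hQIJ : h * Q * I ∈ J := by
    have h1 : h * Q * I = h * a ^ q * C l - h * R := by linear_combination -h * g2
    rw [h1]
    exact sub_mem (Ideal.mul_mem_left _ _ (hC.mem l hl)) (hspanJ (hsub hmem))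
  -- degree and leading coefficient of the pseudo-quotient
  have hQI : Q * I = a ^ q * C l - R := by linear_combination -g2
  set s := ini (C l) with hs
  have hs0 : s ≠ 0 := ini_ne_zero (hC.cls_eq l hl)
  have haq : ∀ v, y l ≤ v → (a ^ q).degreeOf v = 0 := fun v hv =>
    degreeOf_pow_eq_zero (hav v hv) q
  have hcoef : coefv (y l) ((C l).degreeOf (y l)) (Q * I) = a ^ q * s := by
    rw [hQI, coefv_sub, coefv_mul_left _ (haq _ le_rfl), coefv_eq_zero (g1.trans hlt), sub_zero,
      hs, hC.ini_eq_lcv hl, lcv]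
  have hdegQI : (Q * I).degreeOf (y l) = (C l).degreeOf (y l) := by
    refine le_antisymm ?_ (not_lt.1 fun hlt' => ?_)
    · rw [hQI]
      exact (degreeOf_sub_le _ _ _).trans
        (max_le (degreeOf_mul_le_of_left (haq _ le_rfl) _) (g1.trans hlt).le)
    · rw [coefv_eq_zero hlt'] at hcoef
      exact mul_ne_zero (pow_ne_zero q ha0) hs0 hcoef.symm
  have hQ0 : Q ≠ 0 := by
    rintro rfl
    rw [zero_mul, degreeOf_zero] at hdegQI
    omega
  have hD := hdegQI
  rw [degreeOf_mul_eq hQ0 hI0] at hD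
  set D := Q.degreeOf (y l) with hDdef
  have hDpos : 0 < D := by omega
  have hQgt : ∀ v, y l < v → Q.degreeOf v = 0 := by
    intro v hv
    have h1 : (Q * I).degreeOf v = 0 := by
      rw [hQI]
      exact degreeOf_sub_eq_zero
        (degreeOf_mul_eq_zero (haq v hv.le) (hC.degreeOf_eq_zero hl hv)) (hRgt v hv)
    rw [degreeOf_mul_eq hQ0 hI0] at h1
    omega
  set c := lcv (y l) Q with hc
  have hcv : ∀ v, y l ≤ v → c.degreeOf v = 0 := by
    intro v hv
    rcases hv.eq_or_lt with rfl | hv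
    · exact degreeOf_coefv_self _ _ _
    · exact Nat.le_zero.1 ((degreeOf_coefv_le _ _ _ _).trans (hQgt v hv).le)
  have hca : c * a = a ^ q * s := by
    have h1 := lcv_mul (y l) Q I
    rw [lcv, hdegQI, hcoef, ← ha] at h1
    exact h1.symm
  -- the iterated resultant
  obtain ⟨r1, r2, r3⟩ := resTS_spec a hpos hpw
  set ρ := resTS a ((List.range' 0 l).map C) with hρ
  have hρge : ∀ v, y l ≤ v → ρ.degreeOf v = 0 := fun v hv => r2 v (hav v hv) fun T hT =>
    hC.degreeOf_eq_zero_of_mem_map_range' (by omega)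
      (fun i _ hi => (hC.lt i l (by omega) hl).trans_le hv) hT
  have hρy : ∀ j < r, ρ.degreeOf (y j) = 0 := by
    intro j hj
    by_cases hjl : j < l
    · exact r1 (C j) (List.mem_map_of_mem (List.mem_range'_1.2 (by omega))) _ (hC.cls_eq j hj)
    · refine hρge _ ?_
      rcases (not_lt.1 hjl).eq_or_lt with rfl | hlj
      · exact le_rfl
      · exact (hC.lt l j hlj hj).le
  obtain ⟨b, hb, hbρ⟩ := exists_mul_sub_mem_span hav (by
    rintro _ ⟨i, hi, rfl⟩ v hv
    exact hC.degreeOf_eq_zero (lt_trans hi hl) ((hC.lt i l hi hl).trans_le hv)) hρge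
    (Ideal.span_mono (Set.insert_subset_insert fun T hT =>
      mem_image_of_mem_map_range' (by omega) hT) r3)
  have hpowJ : ρ ^ q - (b * a) ^ q ∈ J := by
    obtain ⟨t, ht⟩ := sub_dvd_pow_sub_pow ρ (b * a) q
    rw [ht]
    exact Ideal.mul_mem_right _ _ (hspanJ hbρ)
  -- the multiplier
  have hA0 : ρ ^ q * s ≠ 0 := mul_ne_zero (pow_ne_zero q hres) hs0
  have hAy : ∀ j < r, (ρ ^ q * s).degreeOf (y j) = 0 := fun j hj =>
    degreeOf_mul_eq_zero (degreeOf_pow_eq_zero (hρy j hj) q) (hinis l hlk j hj)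
  have hba : ∀ v, y l ≤ v → (b ^ q * a).degreeOf v = 0 := fun v hv =>
    degreeOf_mul_eq_zero (degreeOf_pow_eq_zero (hb v hv) q) (hav v hv)
  obtain ⟨hV0, hVdeg⟩ := plexDeg_mul_X_pow_add (B := b ^ q * a * (Q - c * X (y l) ^ D)) hA0
    (fun v hv => by
      obtain ⟨j, hj, rfl⟩ := hge v hv
      exact hAy j hj)
    (fun v hv => degreeOf_mul_eq_zero (hba v hv.le) (degreeOf_sub_eq_zero (hQgt v hv)
      (degreeOf_mul_eq_zero (hcv v hv.le) (degreeOf_pow_eq_zero (degreeOf_X_of_ne hv.ne') _))))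
    ((degreeOf_mul_le_of_left (hba _ le_rfl) _).trans_lt (degreeOf_sub_lcv_mul_lt hDpos))
  set V := ρ ^ q * s * X (y l) ^ D + b ^ q * a * (Q - c * X (y l) ^ D) with hV
  have hVeq : V = b ^ q * a * Q + (ρ ^ q - (b * a) ^ q) * s * X (y l) ^ D := by
    rw [hV]
    linear_combination -b ^ q * X (y l) ^ D * hca
  have hWdeg : ∀ i < r, plexDeg (h * V) (y i) = Finsupp.single (y l) D (y i) := by
    intro i hi
    have h1 := plexDeg_apply_le h (y i)
    have h2 := plexDeg_apply_le (ρ ^ q * s) (y i)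
    rw [hhy i hi] at h1
    rw [hAy i hi] at h2
    rw [plexDeg_mul hh0 hV0, hVdeg, Finsupp.add_apply, Finsupp.add_apply, Nat.le_zero.1 h1,
      Nat.le_zero.1 h2, zero_add, zero_add]
  refine ⟨h * V, mul_ne_zero hh0 hV0, ?_, ?_, fun i hi hil => ?_⟩
  · have h1 : h * V * I = b ^ q * a * (h * Q * I) +
        h * s * X (y l) ^ D * I * (ρ ^ q - (b * a) ^ q) := by
      rw [hVeq]
      ring
    rw [h1]
    exact add_mem (Ideal.mul_mem_left _ _ hQIJ) (Ideal.mul_mem_left _ _ hpowJ)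
  · rw [hWdeg l hl, Finsupp.single_eq_same, hD]
  · rw [hWdeg i hi, Finsupp.single_eq_of_ne]
    rcases lt_or_gt_of_ne hil with h1 | h1
    · exact (hC.lt i l h1 hl).ne
    · exact (hC.lt l i h1 hi).ne'

theorem premTS_append_ini_append_eq_zero (hC : IsPlexTriangular J r C y) {k l : ℕ} (hk : k < r)
    (hlk : l < k) (hinis : ∀ i < k, ∀ j < r, (ini (C i)).degreeOf (y j) = 0)
    (hcls : cls (ini (C k)) = y l + 1)
    (hlt : (ini (C k)).degreeOf (y l) < (C l).degreeOf (y l))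
    (hres : resTS (ini (ini (C k))) ((List.range' 0 l).map C) ≠ 0) :
    premTS (C k) ((List.range' 0 l).map C ++ [ini (C k)] ++
      (List.range' (l + 1) (k - l - 1)).map C) = 0 := by
  have hl := hlk.trans hk
  obtain ⟨W, hW, hWI, hWl, hWi⟩ := hC.exists_mul_ini_mem hk hlk hinis hcls hlt hres
  have hpos : ∀ T ∈ (List.range' 0 l).map C ++ [ini (C k)] ++
      (List.range' (l + 1) (k - l - 1)).map C, 0 < cls T := by
    intro T hT
    rcases List.mem_append.1 hT with hT | hT
    · exact hC.cls_pos_append_ini hl hcls T hT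
    · exact hC.cls_pos_of_mem (by omega) T hT
  have hpw : ((List.range' 0 l).map C ++ [ini (C k)] ++
      (List.range' (l + 1) (k - l - 1)).map C).Pairwise fun A B => cls A < cls B := by
    refine List.pairwise_append.2 ⟨hC.pairwise_cls_append_ini hl hcls,
      hC.pairwise_cls (by omega), fun A hA B hB => ?_⟩
    have hAl : cls A ≤ y l + 1 := by
      rcases List.mem_append.1 hA with hA | hA
      · obtain ⟨i, hi, rfl⟩ := mem_image_of_mem_map_range' (k := l) (by omega) hA
        rw [hC.cls_eq i (lt_trans hi hl)]
        have := hC.lt i l hi hl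
        omega
      · rw [List.mem_singleton.1 hA, hcls]
    obtain ⟨i, hi, rfl⟩ := List.mem_map.1 hB
    rw [List.mem_range'_1] at hi
    rw [hC.cls_eq i (by omega)]
    have := hC.lt l i (by omega) (by omega)
    omega
  have hred := (premTS_spec (C k) hpos hpw).1
  refine hC.premTS_eq_zero_of_mul_ini_mem hk hW hWI hpos hpw (fun T hT => ?_)
    (fun i hki hi => hWi i hi (by omega)) fun i hi => ?_
  · rcases List.mem_append.1 hT with hT | hT
    · rcases List.mem_append.1 hT with hT | hT
      · exact Or.inr (mem_image_of_mem_map_range' (by omega) hT)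
      · exact Or.inl (List.mem_singleton.1 hT)
    · exact Or.inr (mem_image_of_mem_map_range' (by omega) hT)
  · by_cases hil : i = l
    · subst hil
      have := hred (ini (C k)) (by simp) _ hcls
      omega
    · rw [hWi i (by omega) hil, add_zero]
      refine hred (C i) ?_ _ (hC.cls_eq i (by omega))
      rcases lt_or_gt_of_ne hil with h1 | h1
      · exact List.mem_append_left _ (List.mem_append_left _
          (List.mem_map_of_mem (List.mem_range'_1.2 (by omega))))
      · exact List.mem_append_right _ (List.mem_map_of_mem (List.mem_range'_1.2 (by omega)))

end IsPlexTriangular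

theorem take_drop_eq_map_range' {α : Type*} (L : List α) (d : α) {a m : ℕ}
    (h : a + m ≤ L.length) :
    (L.drop a).take m = (List.range' a m).map fun i => L.getD i d := by
  refine List.ext_getElem (by simp; omega) fun i h1 h2 => ?_
  simp only [List.length_map, List.length_range'] at h2
  simp [List.getElem?_eq_getElem (show a + i < L.length by omega)]

theorem take_eq_map_range' {α : Type*} (L : List α) (d : α) {m : ℕ} (h : m ≤ L.length) :
    L.take m = (List.range' 0 m).map fun i => L.getD i d := by
  rw [← take_drop_eq_map_range' L d (by omega), List.drop_zero]

/-- A W-characteristic set whose leading variables are the greatest variables is triangular in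
the sense of `IsPlexTriangular`. -/
theorem IsWCharSet.isPlexTriangular {J : Ideal (MvPolynomial (Fin n) K)}
    {Cs : List (MvPolynomial (Fin n) K)} (hW : IsWCharSet J Cs) (hle : Cs.length ≤ n)
    (hord : ∀ i, i < Cs.length → cls (Cs.getD i 0) = n - Cs.length + i + 1)
    {y : ℕ → Fin n} (hy : ∀ i < Cs.length, (y i : ℕ) = n - Cs.length + i) :
    IsPlexTriangular J Cs.length (fun i => Cs.getD i 0) y where
  cls_eq i hi := by rw [hord i hi, hy i hi]
  lt i j hij hj := Fin.lt_def.2 (by rw [hy i (hij.trans hj), hy j hj]; omega)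
  exists_eq i hi v hv := by
    have h1 := Fin.le_def.1 hv
    rw [hy i hi] at h1
    have h2 := v.2
    refine ⟨v - (n - Cs.length), by omega, Fin.ext ?_⟩
    rw [hy _ (by omega)]
    omega
  mem i hi := by
    obtain ⟨G, hG, -, hCG, -⟩ := hW
    exact (hG.1 _ (hCG _ (by rw [List.getD_eq_getElem _ _ hi]; exact List.getElem_mem hi))).1
  lead F hF hF0 := by
    obtain ⟨G, hG, -, hCG, hGC, hmin⟩ := hW
    obtain ⟨g, hg, mg, mF, hmg, hmF, hdvd⟩ := hG.2.1 F hF hF0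
    obtain ⟨c, hc, hcg⟩ := hGC g hg
    obtain ⟨i, hi, rfl⟩ := List.getElem_of_mem hc
    have hgetD : Cs.getD i 0 = Cs[i] := List.getD_eq_getElem _ _ hi
    have hclsc : cls (Cs.getD i 0) = y i + 1 := by rw [hord i hi, hy i hi]
    have hclsg : cls g = y i + 1 := by rw [← hcg, ← hgetD, hclsc]
    rw [hmF.eq_plexDeg, hmg.eq_plexDeg] at hdvd
    have hcg' : ¬ plexLT (plexDeg g) (plexDeg (Cs.getD i 0)) := by
      by_cases heq : g = Cs[i]
      · rw [heq, hgetD]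
        exact fun h => plexLT_asymm h h
      · obtain ⟨mc, mg', h1, h2, h3⟩ := hmin _ hc g hg hcg.symm heq
        rw [h1.eq_plexDeg, h2.eq_plexDeg, ← hgetD] at h3
        exact plexLT_asymm h3
    have hc1 := (cls_eq_succ_iff.1 hclsc).2
    have hg1 := (cls_eq_succ_iff.1 hclsg).2
    refine ⟨i, hi, ?_, fun hlt => hcg' ?_⟩
    · refine le_trans ?_ (hdvd (y i))
      rw [plexDeg_apply_eq_degreeOf hg1]
      exact not_lt.1 fun hlt => hcg' (plexLT_plexDeg_of_degreeOf_lt hc1 hg1 hlt)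
    · rw [← plexOrder_lt_iff] at hlt ⊢
      exact ((plexOrder n).toSyn_monotone hdvd).trans_lt hlt

/-- Theorem mainth. Let `C = [C_1, …, C_r]` be the W-characteristic set
of `⟨P⟩` under the variable ordering in which the leading variables of the `C_i` are the
`r` greatest variables, with `C_i = [C_1, …, C_i]`. If `C` is abnormal, then there is an
integer `1 ≤ k < r` such that: (a) `C_k` is normal and thus regular; (b) `C_{k+1}` is not
regular; (c) writing `I_{k+1} = ini(C_{k+1})` and `y_l = lv(I_{k+1})`, if `I_{k+1}` is not
R-reduced w.r.t. `C_l` then `prem(I_{k+1}, C_l) = 0` and `prem(C_{k+1}, C_k) = 0`; and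
(d) if `I_{k+1}` is R-reduced w.r.t. `C_l` then `prem(C_l, [C_1, …, C_{l−1}, I_{k+1}]) = 0`
and either `res(ini(I_{k+1}), [C_1, …, C_{l−1}]) = 0` or
`prem(C_{k+1}, [C_1, …, C_{l−1}, I_{k+1}, C_{l+1}, …, C_k]) = 0`.
(0-based indexing: `C_{k+1} = Cs.getD k 0`, `C_l = Cs.getD l 0`, the set
`C_l = Cs.take (l+1)`, `[C_1, …, C_{l−1}] = Cs.take l`.) -/
theorem statement17 {n : ℕ} {K : Type*} [Field K]
    (P : Finset (MvPolynomial (Fin n) K)) (hne : P.Nonempty) (h0 : ∀ p ∈ P, p ≠ 0)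
    (hproper : Ideal.span (P : Set (MvPolynomial (Fin n) K)) ≠ ⊤)
    (Cs : List (MvPolynomial (Fin n) K))
    (hW : IsWCharSet (Ideal.span (P : Set (MvPolynomial (Fin n) K))) Cs)
    (hord : ∀ i, i < Cs.length → cls (Cs.getD i 0) = n - Cs.length + i + 1)
    (habn : ¬ NormalSet Cs) :
    ∃ k : ℕ, 1 ≤ k ∧ k < Cs.length ∧
      (NormalSet (Cs.take k) ∧ RegularSet (Cs.take k)) ∧
      ¬ RegularSet (Cs.take (k + 1)) ∧
      ∀ l, l < Cs.length → cls (ini (Cs.getD k 0)) = cls (Cs.getD l 0) →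
        (¬ RReduced (ini (Cs.getD k 0)) (Cs.getD l 0) →
            premTS (ini (Cs.getD k 0)) (Cs.take (l + 1)) = 0 ∧
              premTS (Cs.getD k 0) (Cs.take k) = 0) ∧
          (RReduced (ini (Cs.getD k 0)) (Cs.getD l 0) →
            premTS (Cs.getD l 0) (Cs.take l ++ [ini (Cs.getD k 0)]) = 0 ∧
              (resTS (ini (ini (Cs.getD k 0))) (Cs.take l) = 0 ∨
                premTS (Cs.getD k 0)
                  (Cs.take l ++ [ini (Cs.getD k 0)] ++
                    (Cs.drop (l + 1)).take (k - l - 1)) = 0)) := by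
  obtain ⟨hle, y, hy⟩ : Cs.length ≤ n ∧
      ∃ y : ℕ → Fin n, ∀ i < Cs.length, (y i : ℕ) = n - Cs.length + i := by
    obtain ⟨p, hp⟩ := hne
    obtain ⟨G, hG, -, -, hGC, -⟩ := hW
    obtain ⟨g, hg, -⟩ := hG.2.1 p (Ideal.subset_span hp) (h0 p hp)
    obtain ⟨c, hc, -⟩ := hGC g hg
    have hlen := List.length_pos_of_mem hc
    have hcls : ∀ i < Cs.length, n - Cs.length + i < n := fun i hi => by
      obtain ⟨v, hv⟩ := exists_cls_eq_succ (P := Cs.getD i 0) (by rw [hord i hi]; omega)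
      have := hord i hi
      have := v.2
      omega
    have hlast := hcls (Cs.length - 1) (by omega)
    refine ⟨by omega, fun i => if hi : i < Cs.length then ⟨_, hcls i hi⟩ else ⟨_, hlast⟩,
      fun i hi => ?_⟩
    simp [hi]
  have hC := hW.isPlexTriangular hle hord hy
  set C : ℕ → MvPolynomial (Fin n) K := fun i => Cs.getD i 0 with hCdef
  have hget : ∀ i, Cs.getD i 0 = C i := fun _ => rfl
  have htake : ∀ m ≤ Cs.length, Cs.take m = (List.range' 0 m).map C :=
    fun m hm => take_eq_map_range' Cs 0 hm
  have hnormal : ∀ m, 1 ≤ m → m ≤ Cs.length →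
      (∀ i < m, ∀ j < i, (ini (C i)).degreeOf (y j) = 0) → NormalSet (Cs.take m) := by
    intro m hm hm' h
    have hpw := hC.pairwise_cls (a := 0) (m := m) (by omega)
    rw [htake m hm']
    refine ⟨⟨?_, hC.cls_pos_of_mem (by omega), List.Pairwise.isChain hpw⟩, ?_⟩
    · simp
      omega
    · rw [List.pairwise_map]
      refine List.Pairwise.imp_of_mem ?_ List.pairwise_lt_range'
      intro j i hj hi hji
      rw [List.mem_range'_1] at hi hj
      rw [degLv_eq (hC.cls_eq j (by omega))]
      exact h i (by omega) j hji
  have hlen : 1 ≤ Cs.length := by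
    by_contra hlen
    obtain ⟨p, hp⟩ := hne
    obtain ⟨i, hi, -⟩ := hC.lead p (Ideal.subset_span hp) (h0 p hp)
    omega
  have hex : ∃ k < Cs.length, ∃ i < k, (ini (C k)).degreeOf (y i) ≠ 0 := by
    by_contra! hcon
    have := hnormal Cs.length hlen le_rfl hcon
    rw [List.take_length] at this
    exact habn this
  classical
  obtain ⟨hk, hbad⟩ := Nat.find_spec hex
  have hmin : ∀ i < Nat.find hex, ∀ j < i, (ini (C i)).degreeOf (y j) = 0 := by
    intro i hi j hj
    by_contra hne'
    exact Nat.find_min hex hi ⟨hi.trans hk, j, hj, hne'⟩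
  set k := Nat.find hex
  have hk1 : 1 ≤ k := by
    obtain ⟨i, hi, -⟩ := hbad
    omega
  have hinis : ∀ i < k, ∀ j < Cs.length, (ini (C i)).degreeOf (y j) = 0 := by
    intro i hi j hj
    by_cases hji : j < i
    · exact hmin i hi j hji
    · refine hC.degreeOf_ini_eq_zero_of_le (hi.trans hk) ?_
      rcases (not_lt.1 hji).eq_or_lt with rfl | hij
      · exact le_rfl
      · exact (hC.lt i j hij hj).le
  have hnk := hnormal k hk1 hk.le hmin
  have hgetD : ∀ m, m ≤ Cs.length → ∀ j < m, (Cs.take m).getD j 0 = C j := fun m hm j hj => by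
    simp [hCdef, hj]
  refine ⟨k, hk1, hk, ⟨hnk, hnk.1, fun j hj0 hj => ?_⟩, fun hreg => ?_, fun l hl hcls => ?_⟩
  · rw [List.length_take, min_eq_left hk.le] at hj
    rw [hgetD k hk.le j hj, List.take_take, min_eq_left hj.le, htake j (by omega)]
    refine resTS_ne_zero (ini_ne_zero (hC.cls_eq j (by omega)))
      (hC.cls_pos_of_mem (by omega)) fun T hT i hi => ?_
    obtain ⟨m, hm, rfl⟩ :=
      IsPlexTriangular.mem_image_of_mem_map_range' (k := j) (by omega) hT
    rw [hC.cls_eq m (lt_trans hm (by omega))] at hi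
    rw [← show y m = i from Fin.ext (by omega)]
    exact hmin j hj m hm
  · refine hreg.2 k (by omega) (by rw [List.length_take]; omega) ?_
    rw [hgetD (k + 1) hk k (Nat.lt_succ_self k), List.take_take, min_eq_left (Nat.le_succ k),
      htake k hk.le]
    exact hC.resTS_ini_eq_zero hk hbad
  · simp only [hget] at hcls ⊢
    rw [hC.cls_eq l hl] at hcls
    have hlk : l < k := by
      refine hC.lt_of_lt hl (not_le.1 fun hle' => ?_)
      have := (cls_eq_succ_iff.1 hcls).1
      rw [hC.degreeOf_ini_eq_zero_of_le hk hle'] at this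
      exact lt_irrefl _ this
    rw [RReduced, degLv_eq (hC.cls_eq l hl), degLv_eq (hC.cls_eq l hl), not_lt,
      htake (l + 1) hl, htake k hk.le, htake l hl.le,
      take_drop_eq_map_range' Cs 0 (by omega)]
    refine ⟨hC.premTS_eq_zero_of_le hk hlk hinis hcls, fun hlt =>
      ⟨hC.premTS_append_ini_eq_zero hk hlk hcls hlt, or_iff_not_imp_left.2 fun hres => ?_⟩⟩
    exact hC.premTS_append_ini_append_eq_zero hk hlk hinis hcls hlt hres

end CharSets
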